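/- arXiv:1912.06043 — 6 statements merged into one kernel-verified Lean document; each statement's English description precedes it below -/
import Mathlib

section
/- Let F be a finite field with q elements and let K be a generalized k-arc in P²(F). If l₁ is a line in P²(F) such that |K ∩ l₁| = 3, then for every line l in P²(F) one has |(K \ l₁) ∩ l| ≤ 2; that is, K \ l₁ is an arc in P²(F). -/
/-- The projective plane over `F`: points are 1-dimensional subspaces of `F³`. -/
abbrev P2 (F : Type*) [Field F] := Projectivization F (Fin 3 → F)

/-- A conic in `P²(F)`: the vanishing set of a nonzero homogeneous quadratic form
in three variables (possibly reducible). -/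
def IsConic {F : Type*} [Field F] (C : Set (P2 F)) : Prop :=
  ∃ Q : MvPolynomial (Fin 3) F, Q ≠ 0 ∧ Q.IsHomogeneous 2 ∧
    C = {p : P2 F | MvPolynomial.eval p.rep Q = 0}

/-- A line in `P²(F)`: the vanishing set of a nonzero linear form in three variables. -/
def IsLine {F : Type*} [Field F] (L : Set (P2 F)) : Prop :=
  ∃ φ : MvPolynomial (Fin 3) F, φ ≠ 0 ∧ φ.IsHomogeneous 1 ∧
    L = {p : P2 F | MvPolynomial.eval p.rep φ = 0}

/-- A generalized arc: no conic contains 6 of its points. -/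
def IsGenArc {F : Type*} [Field F] (K : Set (P2 F)) : Prop :=
  ∀ C : Set (P2 F), IsConic C → (K ∩ C).ncard ≤ 5

/-- An arc: no line contains 3 of its points. -/
def IsArc {F : Type*} [Field F] (K : Set (P2 F)) : Prop :=
  ∀ L : Set (P2 F), IsLine L → (K ∩ L).ncard ≤ 2

/-- The union of two lines is a (reducible) conic. -/
theorem IsLine.isConic_union {F : Type*} [Field F] {L M : Set (P2 F)}
    (hL : IsLine L) (hM : IsLine M) : IsConic (L ∪ M) := by
  obtain ⟨φ, hφ, hφ₁, rfl⟩ := hL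
  obtain ⟨ψ, hψ, hψ₁, rfl⟩ := hM
  refine ⟨φ * ψ, mul_ne_zero hφ hψ, hφ₁.mul hψ₁, ?_⟩
  ext p
  simp

/-- If `K` is a generalized `k`-arc in `P²(F)` and `l₁` is a line with
`|K ∩ l₁| = 3`, then every line meets `K \ l₁` in at most 2 points, i.e. `K \ l₁` is an arc. -/
theorem stmt0 {F : Type*} [Field F] [Fintype F] (q k : ℕ) (hq : Fintype.card F = q)
    (K : Set (P2 F)) (hcard : K.ncard = k) (hgen : IsGenArc K)
    (l₁ : Set (P2 F)) (hl₁ : IsLine l₁) (h3 : (K ∩ l₁).ncard = 3) :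
    ∀ l : Set (P2 F), IsLine l → ((K \ l₁) ∩ l).ncard ≤ 2 := by
  intro l hl
  have hfin : Finite (P2 F) :=
    Finite.of_injective Projectivization.rep fun p p' h => by
      rw [← p.mk_rep, ← p'.mk_rep]
      simp only [h]
  have hdecomp : K ∩ (l₁ ∪ l) = K ∩ l₁ ∪ (K \ l₁) ∩ l := by
    ext p
    simp only [Set.mem_inter_iff, Set.mem_union, Set.mem_sdiff]
    tauto
  have hdisj : Disjoint (K ∩ l₁) ((K \ l₁) ∩ l) :=
    Set.disjoint_left.2 fun _ hp hp' => hp'.1.2 hp.2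
  have h5 := hgen _ (hl₁.isConic_union hl)
  rw [hdecomp, Set.ncard_union_eq hdisj (Set.toFinite _) (Set.toFinite _), h3] at h5
  omega
end

section
/- In the projective plane P²(F₂) over the field with 2 elements, every conic contains at most 5 points; consequently the set of all 7 points of P²(F₂) is a generalized 7-arc, and m_g(2,2) = 7. -/
open Finset in
theorem MvPolynomial.IsHomogeneous.eval_eq_sum_antidiagonalTuple {R : Type*} [CommSemiring R]
    {k n : ℕ} {Q : MvPolynomial (Fin k) R} (hQ : Q.IsHomogeneous n) (v : Fin k → R) :
    MvPolynomial.eval v Q = ∑ t ∈ Nat.antidiagonalTuple k n,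
      Q.coeff (Finsupp.equivFunOnFinite.symm t) * ∏ i, v i ^ t i := by
  rw [MvPolynomial.eval_eq']
  refine (Finset.sum_subset (s₂ := (Nat.antidiagonalTuple k n).map
    Finsupp.equivFunOnFinite.symm.toEmbedding) ?_ ?_).trans ?_
  · intro d hd
    have h := hQ (MvPolynomial.mem_support_iff.mp hd)
    rw [Finsupp.weight_apply, Finsupp.sum_fintype _ _ (by simp)] at h
    simp only [Finset.mem_map, Nat.mem_antidiagonalTuple]
    exact ⟨d, by simpa using h, by simp⟩
  · intro d _ hd
    rw [MvPolynomial.notMem_support_iff.mp hd, zero_mul]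
  · simp

theorem MvPolynomial.IsHomogeneous.exists_coeff_ne_zero {R : Type*} [CommSemiring R]
    {k n : ℕ} {Q : MvPolynomial (Fin k) R} (hQ : Q.IsHomogeneous n) (h0 : Q ≠ 0) :
    ∃ t ∈ Finset.Nat.antidiagonalTuple k n, Q.coeff (Finsupp.equivFunOnFinite.symm t) ≠ 0 := by
  obtain ⟨d, hd⟩ := MvPolynomial.ne_zero_iff.mp h0
  have h := hQ hd
  rw [Finsupp.weight_apply, Finsupp.sum_fintype _ _ (by simp)] at h
  exact ⟨d, Finset.Nat.mem_antidiagonalTuple.mpr (by simpa using h), by simpa using hd⟩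

theorem antidiagonalTuple_three_two : Finset.Nat.antidiagonalTuple 3 2 =
    {![2, 0, 0], ![0, 2, 0], ![0, 0, 2], ![1, 1, 0], ![1, 0, 1], ![0, 1, 1]} := by
  decide

set_option synthInstance.maxHeartbeats 200000 in
set_option synthInstance.maxSize 1024 in
set_option maxRecDepth 10000 in
theorem card_zeros_quadratic_form_le_five : ∀ a b c d e f : ZMod 2,
    (a ≠ 0 ∨ b ≠ 0 ∨ c ≠ 0 ∨ d ≠ 0 ∨ e ≠ 0 ∨ f ≠ 0) →
    (Finset.univ.filter fun v : Fin 3 → ZMod 2 => v ≠ 0 ∧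
      a * v 0 ^ 2 + (b * v 1 ^ 2 + (c * v 2 ^ 2 +
        (d * (v 0 * v 1) + (e * (v 0 * v 2) + f * (v 1 * v 2))))) = 0).card ≤ 5 := by
  decide

theorem IsConic.ncard_le_five {C : Set (P2 (ZMod 2))} (hC : IsConic C) : C.ncard ≤ 5 := by
  obtain ⟨Q, h0, hQ, rfl⟩ := hC
  obtain ⟨t, ht, htc⟩ := hQ.exists_coeff_ne_zero h0
  have hle := card_zeros_quadratic_form_le_five
    (Q.coeff (Finsupp.equivFunOnFinite.symm ![2, 0, 0]))
    (Q.coeff (Finsupp.equivFunOnFinite.symm ![0, 2, 0]))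
    (Q.coeff (Finsupp.equivFunOnFinite.symm ![0, 0, 2]))
    (Q.coeff (Finsupp.equivFunOnFinite.symm ![1, 1, 0]))
    (Q.coeff (Finsupp.equivFunOnFinite.symm ![1, 0, 1]))
    (Q.coeff (Finsupp.equivFunOnFinite.symm ![0, 1, 1])) (by
      rw [antidiagonalTuple_three_two] at ht
      simp only [Finset.mem_insert, Finset.mem_singleton] at ht
      rcases ht with rfl | rfl | rfl | rfl | rfl | rfl <;> tauto)
  refine le_trans ?_ hle
  rw [← Set.ncard_coe_finset]
  refine Set.ncard_le_ncard_of_injOn Projectivization.rep ?_ ?_ (Finset.finite_toSet _)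
  · intro p hp
    have hp' : MvPolynomial.eval p.rep Q = 0 := hp
    rw [hQ.eval_eq_sum_antidiagonalTuple, antidiagonalTuple_three_two] at hp'
    repeat rw [Finset.sum_insert (by decide)] at hp'
    rw [Finset.sum_singleton] at hp'
    simpa [Fin.prod_univ_three, p.rep_nonzero] using hp'
  · intro p _ q _ h
    rw [← p.mk_rep, ← q.mk_rep]
    congr 1

theorem ncard_univ_P2_zmod_two : (Set.univ : Set (P2 (ZMod 2))).ncard = 7 := by
  rw [Set.ncard_univ, Projectivization.card_of_finrank (ZMod 2) (Fin 3 → ZMod 2) (n := 3) (by simp)]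
  simp [Finset.sum_range_succ]

theorem isGenArc_zmod_two (K : Set (P2 (ZMod 2))) : IsGenArc K := fun _ hC =>
  (Set.ncard_le_ncard Set.inter_subset_right).trans hC.ncard_le_five

/-- in `P²(F₂)` every conic has at most 5 points; consequently the set of
all 7 points of `P²(F₂)` is a generalized 7-arc, and `m_g(2,2) = 7`. -/
theorem stmt2 :
    (∀ C : Set (P2 (ZMod 2)), IsConic C → C.ncard ≤ 5) ∧
    (Set.univ : Set (P2 (ZMod 2))).ncard = 7 ∧
    IsGenArc (Set.univ : Set (P2 (ZMod 2))) ∧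
    IsGreatest {k : ℕ | ∃ K : Set (P2 (ZMod 2)), K.ncard = k ∧ IsGenArc K} 7 := by
  refine ⟨fun _ hC => hC.ncard_le_five, ncard_univ_P2_zmod_two, isGenArc_zmod_two _,
    ⟨Set.univ, ncard_univ_P2_zmod_two, isGenArc_zmod_two _⟩, ?_⟩
  rintro k ⟨K, rfl, _⟩
  rw [← ncard_univ_P2_zmod_two]
  exact Set.ncard_le_ncard (Set.subset_univ K)
end

section
/- Every generalized k-arc in the projective plane P²(F₃) over the field with 3 elements satisfies k ≤ 7. -/
/-- The ternary quadratic form with prescribed coefficients. -/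
noncomputable def quadraticForm {F : Type*} [Field F]
    (a : (Finset.univ : Finset (Fin 3)).finsuppAntidiag 2 → F) : MvPolynomial (Fin 3) F :=
  ∑ d, MvPolynomial.monomial d.1 (a d)

theorem coeff_quadraticForm {F : Type*} [Field F]
    (a : (Finset.univ : Finset (Fin 3)).finsuppAntidiag 2 → F)
    (d : (Finset.univ : Finset (Fin 3)).finsuppAntidiag 2) :
    (quadraticForm a).coeff d.1 = a d := by
  classical
  simp [quadraticForm, MvPolynomial.coeff_sum, MvPolynomial.coeff_monomial]

theorem isHomogeneous_quadraticForm {F : Type*} [Field F]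
    (a : (Finset.univ : Finset (Fin 3)).finsuppAntidiag 2 → F) :
    (quadraticForm a).IsHomogeneous 2 := by
  refine MvPolynomial.IsHomogeneous.sum _ _ _ fun d _ ↦ MvPolynomial.isHomogeneous_monomial _ ?_
  rw [Finsupp.degree_eq_sum]
  exact (Finset.mem_finsuppAntidiag.1 d.2).1

theorem quadraticForm_injective {F : Type*} [Field F] :
    Function.Injective (quadraticForm (F := F)) := fun a b h ↦ funext fun d ↦ by
  rw [← coeff_quadraticForm a, h, coeff_quadraticForm]

theorem card_finsuppAntidiag_fin_three_two :
    ((Finset.univ : Finset (Fin 3)).finsuppAntidiag 2).card = 6 := by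
  decide

theorem IsGenArc.not_eight {K : Set (P2 (ZMod 3))} (hgen : IsGenArc K) (hK : K.Finite)
    (f : Fin 8 ↪ P2 (ZMod 3)) (hf : ∀ i, f i ∈ K) : False := by
  let g : ((Finset.univ : Finset (Fin 3)).finsuppAntidiag 2 → ZMod 3) × Fin 8 × (ZMod 3)ˣ →
      Fin 8 → ZMod 3 := fun x i ↦
    MvPolynomial.eval (f i).rep (quadraticForm x.1) + Pi.single (M := fun _ ↦ ZMod 3) x.2.1 x.2.2 i
  obtain ⟨⟨a, i, c⟩, ⟨b, j, d⟩, hne, h⟩ := Fintype.exists_ne_map_eq_of_card_lt g (by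
    simp [card_finsuppAntidiag_fin_three_two, ZMod.card_units_eq_totient,
      Nat.totient_prime Nat.prime_three])
  by_cases hab : a = b
  · subst hab
    have hs : Pi.single (M := fun _ ↦ ZMod 3) i (c : ZMod 3) = Pi.single j (d : ZMod 3) :=
      funext fun l ↦ add_left_cancel (congrFun h l)
    have hij : i = j := by
      by_contra hij
      have := congrFun hs i
      simp [Pi.single_eq_of_ne hij] at this
    subst hij
    exact hne (by rw [Units.ext (Pi.single_injective (M := fun _ ↦ ZMod 3) i hs)])
  · have hle := hgen _ ⟨quadraticForm a - quadraticForm b,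
      sub_ne_zero.2 (quadraticForm_injective.ne hab),
      (isHomogeneous_quadraticForm a).sub (isHomogeneous_quadraticForm b), rfl⟩
    have hsub : ((({i, j} : Finset (Fin 8))ᶜ.map f : Finset _) : Set (P2 (ZMod 3))) ⊆
        K ∩ {p | MvPolynomial.eval p.rep (quadraticForm a - quadraticForm b) = 0} := by
      intro p hp
      obtain ⟨l, hl, rfl⟩ := Finset.mem_map.1 hp
      simp only [Finset.mem_compl, Finset.mem_insert, Finset.mem_singleton, not_or] at hl
      refine ⟨hf l, ?_⟩
      have := congrFun h l
      simp only [g, Pi.single_eq_of_ne hl.1, Pi.single_eq_of_ne hl.2, add_zero] at this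
      simp [this]
    have hcard := Set.ncard_le_ncard hsub (hK.inter_of_left _)
    rw [Set.ncard_coe_finset, Finset.card_map, Finset.card_compl, Fintype.card_fin] at hcard
    have := Finset.card_le_two (a := i) (b := j)
    omega

/-- every generalized `k`-arc in `P²(F₃)` satisfies `k ≤ 7`. -/
theorem stmt3 (k : ℕ) (K : Set (P2 (ZMod 3))) (hcard : K.ncard = k)
    (hgen : IsGenArc K) : k ≤ 7 := by
  by_contra! hk
  have hK : K.Finite := Set.finite_of_ncard_pos (by omega)
  have := hK.fintype
  obtain ⟨f⟩ := Function.Embedding.nonempty_of_card_le (α := Fin 8) (β := K) (by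
    rw [Fintype.card_fin, ← Nat.card_eq_fintype_card, Nat.card_coe_set_eq]; omega)
  exact hgen.not_eight hK (f.trans (Function.Embedding.subtype _)) fun i ↦ (f i).2
end

section
/- In the projective plane P²(F₃) over the field with 3 elements, the set of 7 points {[0:1:2], [1:1:1], [1:1:2], [1:0:1], [1:2:0], [1:1:0], [0:1:0]} is a generalized 7-arc; together with the upper bound m_g(2,3) ≤ 7 this gives m_g(2,3) = 7. -/
open Configuration Finset in
/-- In a projective plane of order 3, two distinct lines cover at least 7 points. -/
theorem seven_le_card_two_lines {P L : Type*} [Membership P L] [ProjectivePlane P L]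
    [Fintype P] [Finite L] [DecidableEq P] [∀ (p : P) (l : L), Decidable (p ∈ l)]
    (h : ProjectivePlane.order P L = 3) {l m : L} (hlm : l ≠ m) :
    7 ≤ #{p : P | p ∈ l ∨ p ∈ m} := by
  have card_line (l : L) : #{p : P | p ∈ l} = 4 := by
    rw [← Fintype.card_subtype, ← Nat.card_eq_fintype_card]
    exact (ProjectivePlane.pointCount_eq P l).trans (by rw [h])
  have inter : #(({p : P | p ∈ l} : Finset P) ∩ ({p : P | p ∈ m} : Finset P)) ≤ 1 := by
    rw [card_le_one]
    intro p hp q hq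
    simp only [mem_inter, mem_filter, mem_univ, true_and] at hp hq
    exact (Nondegenerate.eq_or_eq hp.1 hq.1 hp.2 hq.2).resolve_right hlm
  have := card_union_add_card_inter ({p : P | p ∈ l} : Finset P) {p : P | p ∈ m}
  rw [card_line, card_line, ← filter_or] at this
  omega

open Configuration Finset in
/-- In a projective plane of order 3, for any set of at most 5 points there are two distinct lines
whose union meets it in at most one point. -/
theorem exists_two_lines_card_inter_le_one {P L : Type*} [Membership P L] [ProjectivePlane P L]
    [Fintype P] [Fintype L] [DecidableEq P] [∀ (p : P) (l : L), Decidable (p ∈ l)]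
    (h : ProjectivePlane.order P L = 3) (B : Finset P) (hB : #B ≤ 5) :
    ∃ l m : L, l ≠ m ∧ #{p ∈ B | p ∈ l ∨ p ∈ m} ≤ 1 := by
  classical
  have card_lines : Fintype.card L = 13 := by
    rw [ProjectivePlane.card_lines P L, h]; rfl
  have sum_eq : ∑ l : L, #{p ∈ B | p ∈ l} = #B * 4 := by
    have key := sum_card_bipartiteAbove_eq_sum_card_bipartiteBelow
      (s := B) (t := (univ : Finset L)) (fun p l => p ∈ l)
    simp only [bipartiteAbove, bipartiteBelow] at key
    rw [← key]
    refine sum_const_nat fun p _ => ?_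
    rw [← Fintype.card_subtype, ← Nat.card_eq_fintype_card]
    exact (ProjectivePlane.lineCount_eq L p).trans (by rw [h])
  by_cases h_external : ∃ l : L, #{p ∈ B | p ∈ l} = 0
  · obtain ⟨l, hl⟩ := h_external
    obtain ⟨m, hm, hm1⟩ : ∃ m ∈ univ.erase l, #{p ∈ B | p ∈ m} ≤ 1 := by
      by_contra! hcon
      have := card_nsmul_le_sum (univ.erase l) (fun m => #{p ∈ B | p ∈ m}) 2 hcon
      rw [card_erase_of_mem (mem_univ l), card_univ, card_lines] at this
      have := add_sum_erase univ (fun m : L => #{p ∈ B | p ∈ m}) (mem_univ l)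
      simp only [smul_eq_mul] at *
      omega
    refine ⟨l, m, (ne_of_mem_erase hm).symm, ?_⟩
    rw [filter_or]
    exact (card_union_le _ _).trans (add_le_add hl.le hm1)
  · push Not at h_external
    have tangents : #B < #{l : L | #{p ∈ B | p ∈ l} = 1} := by
      have h1 : ∑ l : L, (2 - if #{p ∈ B | p ∈ l} = 1 then 1 else 0) ≤
          ∑ l : L, #{p ∈ B | p ∈ l} := by
        refine sum_le_sum fun l _ => ?_
        have := h_external l
        split_ifs <;> omega
      have h2 : ∑ l : L, (2 - if #{p ∈ B | p ∈ l} = 1 then 1 else 0) +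
          ∑ l : L, (if #{p ∈ B | p ∈ l} = 1 then 1 else 0) = 13 * 2 := by
        rw [← sum_add_distrib, ← card_lines, ← card_univ]
        refine sum_const_nat fun l _ => ?_
        split_ifs <;> rfl
      rw [card_filter]
      omega
    have point (l : L) : ∃ p, #{p ∈ B | p ∈ l} = 1 → {p ∈ B | p ∈ l} = {p} := by
      by_cases hl : #{p ∈ B | p ∈ l} = 1
      · obtain ⟨p, hp⟩ := card_eq_one.1 hl
        exact ⟨p, fun _ => hp⟩
      · obtain ⟨p, -⟩ := card_pos.1 (Nat.pos_of_ne_zero (h_external l))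
        exact ⟨p, fun h => absurd h hl⟩
    choose f hf using point
    obtain ⟨l, hl, m, hm, hlm, hfl⟩ := exists_ne_map_eq_of_card_lt_of_maps_to tangents
      (f := f) (fun l hl => by
        have hl1 := hf l (mem_filter.1 (mem_coe.1 hl)).2
        exact mem_coe.2 (mem_filter.1 (hl1 ▸ mem_singleton_self (f l))).1)
    refine ⟨l, m, hlm, ?_⟩
    rw [filter_or, hf l (mem_filter.1 hl).2, hf m (mem_filter.1 hm).2, hfl, union_self,
      card_singleton]

/-- The union of two lines is a conic. -/
theorem isConic_two_lines {F : Type*} [Field F] (l m : P2 F) :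
    IsConic {p : P2 F | p.orthogonal l ∨ p.orthogonal m} := by
  have linear (l : P2 F) : ∃ φ : MvPolynomial (Fin 3) F, φ ≠ 0 ∧ φ.IsHomogeneous 1 ∧
      ∀ p : P2 F, MvPolynomial.eval p.rep φ = 0 ↔ p.orthogonal l := by
    have heval (x : Fin 3 → F) :
        MvPolynomial.eval x (∑ i, MvPolynomial.C (l.rep i) * MvPolynomial.X i) = x ⬝ᵥ l.rep := by
      simp [dotProduct, mul_comm]
    refine ⟨∑ i, MvPolynomial.C (l.rep i) * MvPolynomial.X i, fun h0 => ?_, ?_, fun p => ?_⟩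
    · refine l.rep_nonzero (dotProduct_eq_zero_iff.1 fun x => ?_)
      rw [dotProduct_comm, ← heval, h0, map_zero]
    · refine MvPolynomial.IsHomogeneous.sum _ _ _ fun i _ => ?_
      simpa using (MvPolynomial.isHomogeneous_C _ _).mul (MvPolynomial.isHomogeneous_X F i)
    · rw [heval, ← Projectivization.orthogonal_mk p.rep_nonzero l.rep_nonzero,
        Projectivization.mk_rep, Projectivization.mk_rep]
  obtain ⟨φ, hφ0, hφ, hφl⟩ := linear l
  obtain ⟨ψ, hψ0, hψ, hψm⟩ := linear m
  refine ⟨φ * ψ, mul_ne_zero hφ0 hψ0, hφ.mul hψ, ?_⟩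
  ext p
  simp [hφl, hψm]

/-- Generalized arcs of the projective plane over `F₃` have at most 7 points. -/
theorem IsGenArc.ncard_le_seven {K : Set (P2 (ZMod 3))} (hK : IsGenArc K) : K.ncard ≤ 7 := by
  classical
  have : Finite (P2 (ZMod 3)) := Quotient.finite _
  have := Fintype.ofFinite (P2 (ZMod 3))
  have card_points : Fintype.card (P2 (ZMod 3)) = 13 := by
    rw [← Nat.card_eq_fintype_card,
      Projectivization.card_of_finrank (ZMod 3) (Fin 3 → ZMod 3) (n := 3) (by simp)]
    simp [Finset.sum_range_succ]
  have order_eq : Configuration.ProjectivePlane.order (P2 (ZMod 3)) (P2 (ZMod 3)) = 3 := by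
    have := Configuration.ProjectivePlane.card_points (P2 (ZMod 3)) (P2 (ZMod 3))
    rw [card_points] at this
    nlinarith
  by_contra! hcard
  obtain ⟨S, rfl⟩ : ∃ S : Finset (P2 (ZMod 3)), K = S := ⟨K.toFinset, by simp⟩
  rw [Set.ncard_coe_finset] at hcard
  have hcompl := Finset.card_add_card_compl S
  obtain ⟨l, m, hlm, hle⟩ := exists_two_lines_card_inter_le_one order_eq Sᶜ (by omega)
  have hseven := seven_le_card_two_lines order_eq hlm
  have hfive := hK _ (isConic_two_lines l m)
  have hinter : (S : Set (P2 (ZMod 3))) ∩ {p | p.orthogonal l ∨ p.orthogonal m} =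
      ({p ∈ S | p ∈ l ∨ p ∈ m} : Finset (P2 (ZMod 3))) := by
    ext p
    simp [Configuration.ofField.mem_iff, and_or_left]
  rw [hinter, Set.ncard_coe_finset] at hfive
  have hsplit := Finset.card_union_le {p ∈ S | p ∈ l ∨ p ∈ m} {p ∈ Sᶜ | p ∈ l ∨ p ∈ m}
  rw [← Finset.filter_union, Finset.union_compl] at hsplit
  exact absurd (hseven.trans (hsplit.trans (add_le_add hfive hle))) (by decide)

/-- The exponents of the quadratic monomials in three variables. -/
def quadraticExponents : Fin 6 → Fin 3 → ℕ :=
  ![![2, 0, 0], ![0, 2, 0], ![0, 0, 2], ![1, 1, 0], ![1, 0, 1], ![0, 1, 1]]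

/-- A nonzero ternary quadratic form is given by a nonzero vector of coefficients. -/
theorem MvPolynomial.IsHomogeneous.exists_quadratic_coeffs {R : Type*} [CommRing R]
    {Q : MvPolynomial (Fin 3) R} (hQ : Q.IsHomogeneous 2) (hQ0 : Q ≠ 0) :
    ∃ c : Fin 6 → R, c ≠ 0 ∧
      ∀ x, MvPolynomial.eval x Q = ∑ k, c k * ∏ i, x i ^ quadraticExponents k i := by
  let e (k : Fin 6) : Fin 3 →₀ ℕ := Finsupp.equivFunOnFinite.symm (quadraticExponents k)
  have he : Function.Injective e :=
    Finsupp.equivFunOnFinite.symm.injective.comp (by unfold quadraticExponents; decide)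
  have hsupp (d : Fin 3 →₀ ℕ) (hd : Q.coeff d ≠ 0) : ∃ k, e k = d := by
    have hdeg : d.degree = 2 := by
      rw [Finsupp.degree_eq_weight_one]
      exact hQ hd
    rw [Finsupp.degree_eq_sum, Fin.sum_univ_three] at hdeg
    have hd' : ∃ k, quadraticExponents k = ![d 0, d 1, d 2] := by
      generalize d 0 = a at *
      generalize d 1 = b at *
      generalize d 2 = c at *
      have ha : a ≤ 2 := by omega
      have hb : b ≤ 2 := by omega
      obtain rfl : c = 2 - a - b := by omega
      unfold quadraticExponents
      interval_cases a <;> interval_cases b <;> first | omega | decide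
    obtain ⟨k, hk⟩ := hd'
    refine ⟨k, Finsupp.ext fun i => ?_⟩
    have := congrFun hk i
    fin_cases i <;> exact this
  refine ⟨fun k => Q.coeff (e k), fun hc => ?_, fun x => ?_⟩
  · obtain ⟨d, hd⟩ := MvPolynomial.ne_zero_iff.1 hQ0
    obtain ⟨k, rfl⟩ := hsupp d hd
    exact hd (congrFun hc k)
  · rw [MvPolynomial.eval_eq', Finset.sum_subset (s₁ := Q.support)
      (s₂ := Finset.univ.map ⟨e, he⟩), Finset.sum_map]
    · rfl
    · intro d hd
      obtain ⟨k, rfl⟩ := hsupp d (MvPolynomial.mem_support_iff.1 hd)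
      simp
    · intro d _ hd
      rw [MvPolynomial.notMem_support_iff.1 hd, zero_mul]

/-- Vanishing of a form at a projective point can be tested on any representative. -/
theorem MvPolynomial.IsHomogeneous.eval_mk_rep_eq_zero_iff {F : Type*} [Field F]
    {Q : MvPolynomial (Fin 3) F} {n : ℕ} (hQ : Q.IsHomogeneous n) (v : Fin 3 → F) (hv : v ≠ 0) :
    MvPolynomial.eval (Projectivization.mk F v hv).rep Q = 0 ↔ MvPolynomial.eval v Q = 0 := by
  obtain ⟨a, ha⟩ := Projectivization.exists_smul_eq_mk_rep F v hv
  have hscale : MvPolynomial.eval (a • v) Q = (a : F) ^ n * MvPolynomial.eval v Q := by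
    rw [MvPolynomial.eval_eq', MvPolynomial.eval_eq', Finset.mul_sum]
    refine Finset.sum_congr rfl fun d hd => ?_
    have hdeg : d.degree = n := by
      rw [Finsupp.degree_eq_weight_one]
      exact hQ (MvPolynomial.mem_support_iff.1 hd)
    rw [Finsupp.degree_eq_sum] at hdeg
    simp only [Pi.smul_apply, Units.smul_def, smul_eq_mul, mul_pow, Finset.prod_mul_distrib,
      Finset.prod_pow_eq_pow_sum, hdeg]
    ring
  rw [← ha, hscale, mul_eq_zero, or_iff_right (pow_ne_zero _ a.ne_zero)]

/-- Representatives of the points of a generalized arc of size 7 over `F₃`. -/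
def sevenArcVec : Fin 7 → Fin 3 → ZMod 3 :=
  ![![0, 1, 2], ![1, 1, 1], ![1, 1, 2], ![1, 0, 1], ![1, 2, 0], ![1, 1, 0], ![0, 1, 0]]

theorem sevenArcVec_ne_zero (i : Fin 7) : sevenArcVec i ≠ 0 := by
  revert i; unfold sevenArcVec; decide

/-- The points of a generalized arc of size 7 over `F₃`. -/
def sevenArcPoint (i : Fin 7) : P2 (ZMod 3) :=
  Projectivization.mk (ZMod 3) (sevenArcVec i) (sevenArcVec_ne_zero i)

theorem sevenArcPoint_injective : Function.Injective sevenArcPoint := by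
  intro i j hij
  obtain ⟨a, ha⟩ := (Projectivization.mk_eq_mk_iff' _ _ _ _ _).1 hij
  clear hij
  revert i j a
  unfold sevenArcVec
  decide +kernel

theorem card_sevenArcVec_quadratic_zeros_le :
    ∀ c : Fin 6 → ZMod 3, c ≠ 0 → Finset.card {i | ∑ k, c k * ∏ j, sevenArcVec i j ^
      quadraticExponents k j = 0} ≤ 5 := by
  decide +kernel

theorem isGenArc_range_sevenArcPoint : IsGenArc (Set.range sevenArcPoint) := by
  rintro _ ⟨Q, hQ0, hQ, rfl⟩
  obtain ⟨c, hc, heval⟩ := hQ.exists_quadratic_coeffs hQ0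
  refine le_trans ?_ (card_sevenArcVec_quadratic_zeros_le c hc)
  rw [← Set.ncard_coe_finset]
  refine (Set.ncard_le_ncard ?_ (Set.toFinite _)).trans
    (Set.ncard_image_le (f := sevenArcPoint) (Set.toFinite _))
  rintro _ ⟨⟨i, rfl⟩, hi⟩
  refine ⟨i, ?_, rfl⟩
  have := (hQ.eval_mk_rep_eq_zero_iff _ (sevenArcVec_ne_zero i)).1 hi
  rw [heval] at this
  simpa using this

theorem ncard_range_sevenArcPoint : (Set.range sevenArcPoint).ncard = 7 := by
  rw [Set.ncard_range_of_injective sevenArcPoint_injective, Nat.card_fin]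

/-- the given 7 points form a generalized 7-arc in `P²(F₃)`,
and together with the upper bound this gives `m_g(2,3) = 7`. -/
theorem stmt4 :
    ({Projectivization.mk (ZMod 3) ![0, 1, 2] (by decide),
      Projectivization.mk (ZMod 3) ![1, 1, 1] (by decide),
      Projectivization.mk (ZMod 3) ![1, 1, 2] (by decide),
      Projectivization.mk (ZMod 3) ![1, 0, 1] (by decide),
      Projectivization.mk (ZMod 3) ![1, 2, 0] (by decide),
      Projectivization.mk (ZMod 3) ![1, 1, 0] (by decide),
      Projectivization.mk (ZMod 3) ![0, 1, 0] (by decide)} : Set (P2 (ZMod 3))).ncard = 7 ∧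
    IsGenArc ({Projectivization.mk (ZMod 3) ![0, 1, 2] (by decide),
      Projectivization.mk (ZMod 3) ![1, 1, 1] (by decide),
      Projectivization.mk (ZMod 3) ![1, 1, 2] (by decide),
      Projectivization.mk (ZMod 3) ![1, 0, 1] (by decide),
      Projectivization.mk (ZMod 3) ![1, 2, 0] (by decide),
      Projectivization.mk (ZMod 3) ![1, 1, 0] (by decide),
      Projectivization.mk (ZMod 3) ![0, 1, 0] (by decide)} : Set (P2 (ZMod 3))) ∧
    IsGreatest {k : ℕ | ∃ K : Set (P2 (ZMod 3)), K.ncard = k ∧ IsGenArc K} 7 := by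
  have hrange : Set.range sevenArcPoint = {Projectivization.mk (ZMod 3) ![0, 1, 2] (by decide),
      Projectivization.mk (ZMod 3) ![1, 1, 1] (by decide),
      Projectivization.mk (ZMod 3) ![1, 1, 2] (by decide),
      Projectivization.mk (ZMod 3) ![1, 0, 1] (by decide),
      Projectivization.mk (ZMod 3) ![1, 2, 0] (by decide),
      Projectivization.mk (ZMod 3) ![1, 1, 0] (by decide),
      Projectivization.mk (ZMod 3) ![0, 1, 0] (by decide)} := by
    ext p
    simp only [Set.mem_range, Fin.exists_fin_succ, Set.mem_insert_iff, Set.mem_singleton_iff,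
      eq_comm (a := p)]
    simp [sevenArcPoint, sevenArcVec]
  rw [← hrange]
  exact ⟨ncard_range_sevenArcPoint, isGenArc_range_sevenArcPoint,
    ⟨_, ncard_range_sevenArcPoint, isGenArc_range_sevenArcPoint⟩,
    fun _ ⟨_, hk, hK⟩ => hk ▸ hK.ncard_le_seven⟩
end

section
/- Every generalized k-arc in the projective plane P²(F₅) over the field with 5 elements satisfies k ≤ 7; hence m_g(2,5) = 7. -/
instance : Fact (Nat.Prime 5) := ⟨by norm_num⟩

section TernaryForms

variable {F : Type*} [Field F]

/-- The six quadratic monomials in three variables. -/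
def veronese (v : Fin 3 → F) : Fin 6 → F :=
  ![v 0 ^ 2, v 1 ^ 2, v 2 ^ 2, v 1 * v 2, v 0 * v 2, v 0 * v 1]

/-- The ternary quadratic form with coefficients `c`. -/
def ternaryForm (c : Fin 6 → F) (v : Fin 3 → F) : F := c ⬝ᵥ veronese v

theorem ternaryForm_apply (c : Fin 6 → F) (v : Fin 3 → F) :
    ternaryForm c v = c 0 * v 0 ^ 2 + c 1 * v 1 ^ 2 + c 2 * v 2 ^ 2 + c 3 * (v 1 * v 2) +
      c 4 * (v 0 * v 2) + c 5 * (v 0 * v 1) := by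
  simp [ternaryForm, veronese, dotProduct, Fin.sum_univ_succ]
  ring

theorem ternaryForm_smul (c : Fin 6 → F) (t : F) (v : Fin 3 → F) :
    ternaryForm c (t • v) = t ^ 2 * ternaryForm c v := by
  simp only [ternaryForm_apply, Pi.smul_apply, smul_eq_mul]
  ring

theorem ternaryForm_sum {m : ℕ} (forms : Fin m → Fin 6 → F) (w : Fin m → F) (v : Fin 3 → F) :
    ternaryForm (∑ j, w j • forms j) v = ∑ j, w j * ternaryForm (forms j) v := by
  simp [ternaryForm, sum_dotProduct, smul_dotProduct]

theorem exists_ternaryForm_ne_zero {c : Fin 6 → F} (hc : c ≠ 0) : ∃ v, ternaryForm c v ≠ 0 := by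
  by_contra! h
  refine hc ?_
  have h0 := h ![1, 0, 0]
  have h1 := h ![0, 1, 0]
  have h2 := h ![0, 0, 1]
  have h3 := h ![0, 1, 1]
  have h4 := h ![1, 0, 1]
  have h5 := h ![1, 1, 0]
  simp [ternaryForm_apply] at h0 h1 h2 h3 h4 h5
  simp only [h0, h1, h2, zero_add] at h3 h4 h5
  ext i
  fin_cases i <;> simp [*]

theorem exists_isHomogeneous_eval_eq (c : Fin 6 → F) (g : (Fin 3 → F) →ₗ[F] (Fin 3 → F)) :
    ∃ Q : MvPolynomial (Fin 3) F, Q.IsHomogeneous 2 ∧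
      ∀ v, MvPolynomial.eval v Q = ternaryForm c (g v) := by
  let L (i : Fin 3) : MvPolynomial (Fin 3) F :=
    ∑ j, MvPolynomial.C (g.toMatrix' i j) * MvPolynomial.X j
  have hL (i : Fin 3) : (L i).IsHomogeneous 1 :=
    MvPolynomial.IsHomogeneous.sum _ _ _ fun j _ => MvPolynomial.isHomogeneous_C_mul_X _ _
  have hLv (i : Fin 3) (v : Fin 3 → F) : MvPolynomial.eval v (L i) = g v i := by
    rw [← LinearMap.toMatrix'_mulVec]
    simp [L, Matrix.mulVec, dotProduct]
  refine ⟨MvPolynomial.C (c 0) * (L 0 * L 0) + MvPolynomial.C (c 1) * (L 1 * L 1) +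
    MvPolynomial.C (c 2) * (L 2 * L 2) + MvPolynomial.C (c 3) * (L 1 * L 2) +
    MvPolynomial.C (c 4) * (L 0 * L 2) + MvPolynomial.C (c 5) * (L 0 * L 1), ?_, fun v => ?_⟩
  · have h (a : F) (i j : Fin 3) : (MvPolynomial.C a * (L i * L j)).IsHomogeneous 2 :=
      ((hL i).mul (hL j)).C_mul a
    exact (((((h _ _ _).add (h _ _ _)).add (h _ _ _)).add (h _ _ _)).add (h _ _ _)).add (h _ _ _)
  · simp [hLv, ternaryForm_apply]
    ring

theorem exists_eval_eq_ternaryForm {Q : MvPolynomial (Fin 3) F} (hQ : Q.IsHomogeneous 2)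
    (hQ0 : Q ≠ 0) : ∃ c : Fin 6 → F, c ≠ 0 ∧ ∀ v, MvPolynomial.eval v Q = ternaryForm c v := by
  let e : Fin 6 → Fin 3 →₀ ℕ := fun k => Finsupp.equivFunOnFinite.symm
    (![![2, 0, 0], ![0, 2, 0], ![0, 0, 2], ![0, 1, 1], ![1, 0, 1], ![1, 1, 0]] k)
  have he : Function.Injective e :=
    Finsupp.equivFunOnFinite.symm.injective.comp (by decide)
  have hsub : Q.support ⊆ Finset.univ.map ⟨e, he⟩ := by
    intro d hd
    have hdeg := hQ (MvPolynomial.mem_support_iff.mp hd)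
    rw [Finsupp.weight_apply, Finsupp.sum_fintype _ _ (by simp)] at hdeg
    simp [Fin.sum_univ_succ] at hdeg
    simp only [Finset.mem_map, Finset.mem_univ, true_and, Function.Embedding.coeFn_mk]
    have hcases : (d 0 = 2 ∧ d 1 = 0 ∧ d 2 = 0) ∨ (d 0 = 0 ∧ d 1 = 2 ∧ d 2 = 0) ∨
        (d 0 = 0 ∧ d 1 = 0 ∧ d 2 = 2) ∨ (d 0 = 0 ∧ d 1 = 1 ∧ d 2 = 1) ∨
        (d 0 = 1 ∧ d 1 = 0 ∧ d 2 = 1) ∨ (d 0 = 1 ∧ d 1 = 1 ∧ d 2 = 0) := by omega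
    rcases hcases with h | h | h | h | h | h
    · exact ⟨0, by ext i; fin_cases i <;> simp [e, h]⟩
    · exact ⟨1, by ext i; fin_cases i <;> simp [e, h]⟩
    · exact ⟨2, by ext i; fin_cases i <;> simp [e, h]⟩
    · exact ⟨3, by ext i; fin_cases i <;> simp [e, h]⟩
    · exact ⟨4, by ext i; fin_cases i <;> simp [e, h]⟩
    · exact ⟨5, by ext i; fin_cases i <;> simp [e, h]⟩
  have hsum (v : Fin 3 → F) :
      MvPolynomial.eval v Q = ternaryForm (fun k => Q.coeff (e k)) v := by
    rw [MvPolynomial.eval_eq', Finset.sum_subset hsub, Finset.sum_map, ternaryForm_apply]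
    · simp [Fin.sum_univ_succ, Fin.prod_univ_succ, e]
      ring
    · intro d _ hd
      simp [MvPolynomial.notMem_support_iff.mp hd]
  refine ⟨_, fun h => hQ0 ?_, hsum⟩
  rw [← MvPolynomial.support_eq_empty, Finset.eq_empty_iff_forall_notMem]
  intro d hd
  obtain ⟨k, -, rfl⟩ := Finset.mem_map.mp (hsub hd)
  exact MvPolynomial.mem_support_iff.mp hd (congrFun h k)

theorem IsGenArc.card_filter_le [DecidableEq F] {S : Finset (P2 F)} (hS : IsGenArc (S : Set (P2 F)))
    (g : (Fin 3 → F) →ₗ[F] (Fin 3 → F)) (c : Fin 6 → F) (h : ∃ v, ternaryForm c (g v) ≠ 0) :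
    (S.filter fun p => ternaryForm c (g p.rep) = 0).card ≤ 5 := by
  obtain ⟨Q, hQ, hQv⟩ := exists_isHomogeneous_eval_eq c g
  obtain ⟨v, hv⟩ := h
  have hQ0 : Q ≠ 0 := by
    rintro rfl
    exact hv (by rw [← hQv, map_zero])
  have := hS _ ⟨Q, hQ0, hQ, rfl⟩
  rw [← Set.ncard_coe_finset]
  convert this using 2
  ext p
  simp [hQv]

theorem IsGenArc.span_rep_eq_top [DecidableEq F] {S : Finset (P2 F)}
    (hS : IsGenArc (S : Set (P2 F))) (hcard : 5 < S.card) :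
    Submodule.span F (Projectivization.rep '' (S : Set (P2 F))) = ⊤ := by
  by_contra h
  obtain ⟨f, hf, hle⟩ := Submodule.exists_le_ker_of_lt_top _ (lt_top_iff_ne_top.mpr h)
  obtain ⟨v, hv⟩ : ∃ v, f v ≠ 0 := by
    by_contra! h'
    exact hf (LinearMap.ext h')
  have := hS.card_filter_le (LinearMap.pi fun _ => f) (Pi.single 0 1)
    ⟨v, by simpa [ternaryForm_apply] using hv⟩
  rw [Finset.filter_true_of_mem] at this
  · omega
  · intro p hp
    have : f p.rep = 0 := hle (Submodule.subset_span ⟨p, hp, rfl⟩)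
    simp [ternaryForm_apply, this]

theorem IsGenArc.exists_basis [DecidableEq F] {S : Finset (P2 F)}
    (hS : IsGenArc (S : Set (P2 F))) (hcard : 5 < S.card) :
    ∃ b : Module.Basis (Fin 3) F (Fin 3 → F), ∀ i, ∃ p ∈ S, p.rep = b i := by
  have hspan := hS.span_rep_eq_top hcard
  have hdim : Module.finrank F
      (Submodule.span F (Projectivization.rep '' (S : Set (P2 F)))) = 3 := by
    rw [hspan, finrank_top, Module.finrank_fin_fun]
  obtain ⟨f, hf, hfs, hli⟩ := Submodule.exists_fun_fin_finrank_span_eq F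
    (Projectivization.rep '' (S : Set (P2 F)))
  replace hfs := hfs.trans hspan
  refine ⟨(Module.Basis.mk hli hfs.ge).reindex (finCongr hdim), fun i => ?_⟩
  obtain ⟨p, hp, hpf⟩ := hf (Fin.cast hdim.symm i)
  exact ⟨p, hp, by simpa using hpf⟩

theorem IsGenArc.exists_forall_coord_ne_zero [DecidableEq F] {S : Finset (P2 F)}
    (hS : IsGenArc (S : Set (P2 F))) (hcard : 8 ≤ S.card)
    (b : Module.Basis (Fin 3) F (Fin 3 → F)) : ∃ p ∈ S, ∀ i, b.equivFun p.rep i ≠ 0 := by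
  classical
  by_contra! h
  have key (k : Fin 6) : (S.filter fun p =>
      ternaryForm (Pi.single k 1) (b.equivFun p.rep) = 0).card ≤ 5 := by
    obtain ⟨v, hv⟩ := exists_ternaryForm_ne_zero (c := Pi.single k (1 : F)) (by simp)
    exact hS.card_filter_le b.equivFun.toLinearMap _ 
      ⟨b.equivFun.symm v, by rwa [LinearEquiv.coe_coe, LinearEquiv.apply_symm_apply]⟩
  have h3 := key 3
  have h4 := key 4
  have h5 := key 5
  simp [ternaryForm_apply] at h3 h4 h5
  set A := S.filter fun p => b.repr p.rep 1 = 0 ∨ b.repr p.rep 2 = 0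
  set B := S.filter fun p => b.repr p.rep 0 = 0 ∨ b.repr p.rep 2 = 0
  set C := S.filter fun p => b.repr p.rep 0 = 0 ∨ b.repr p.rep 1 = 0
  have hdisj : Disjoint (S \ A) (S \ B) := by
    rw [Finset.disjoint_left]
    intro p hA hB
    obtain ⟨i, hi⟩ := h p (Finset.mem_sdiff.mp hA).1
    fin_cases i <;> simp_all [A, B]
  have hsub : S \ A ∪ S \ B ⊆ C := by
    intro p hp
    have hpS : p ∈ S := by
      simp only [Finset.mem_union, Finset.mem_sdiff] at hp
      tauto
    obtain ⟨i, hi⟩ := h p hpS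
    fin_cases i <;> simp_all [A, B, C]
  have := Finset.card_le_card hsub
  rw [Finset.card_union_of_disjoint hdisj] at this
  have := Finset.le_card_sdiff A S
  have := Finset.le_card_sdiff B S
  omega

theorem IsGenArc.exists_frame [DecidableEq F] {S : Finset (P2 F)}
    (hS : IsGenArc (S : Set (P2 F))) (hcard : 8 ≤ S.card) :
    ∃ g : (Fin 3 → F) ≃ₗ[F] (Fin 3 → F),
      (∀ i, ∃ p ∈ S, ∃ t : F, t ≠ 0 ∧ t • g p.rep = Pi.single i 1) ∧ ∃ p ∈ S, g p.rep = 1 := by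
  obtain ⟨b, hb⟩ := hS.exists_basis (by omega)
  obtain ⟨p, hp, hp0⟩ := hS.exists_forall_coord_ne_zero hcard b
  let b' := b.isUnitSMul fun i => (hp0 i).isUnit
  refine ⟨b'.equivFun, fun i => ?_, p, hp, ?_⟩
  · obtain ⟨q, hq, hqb⟩ := hb i
    refine ⟨q, hq, _, hp0 i, ?_⟩
    rw [hqb, ← map_smul, ← b.isUnitSMul_apply fun i => (hp0 i).isUnit]
    ext j
    simp [b', Pi.single_apply, eq_comm]
  · apply b'.equivFun.symm.injective
    rw [LinearEquiv.symm_apply_apply]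
    simp [Module.Basis.equivFun_symm_apply, b', Module.Basis.isUnitSMul_apply]

end TernaryForms

/-- Normalised representatives of the points of the plane over the field with five elements. -/
def planePoint (n : Fin 31) : Fin 3 → ZMod 5 :=
  if n.val < 25 then ![1, (n.val / 5 : ℕ), (n.val % 5 : ℕ)]
  else if n.val < 30 then ![0, 1, (n.val % 5 : ℕ)] else ![0, 0, 1]

/-- Vanishes when `u`, `v` and the standard frame lie on a common conic. -/
def frameDet (u v : Fin 3 → ZMod 5) : ZMod 5 :=
  (u 1 * u 2 - u 0 * u 1) * (v 0 * v 2 - v 0 * v 1) -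
    (u 0 * u 2 - u 0 * u 1) * (v 1 * v 2 - v 0 * v 1)

/-- The determinant of the matrix with rows `u`, `v`, `w`. -/
def tripleDet (u v w : Fin 3 → ZMod 5) : ZMod 5 :=
  u 0 * (v 1 * w 2 - v 2 * w 1) - u 1 * (v 0 * w 2 - v 2 * w 0) + u 2 * (v 0 * w 1 - v 1 * w 0)

/-- The values of the conics through the three coordinate points. -/
def crossTerms (v : Fin 3 → ZMod 5) : Fin 3 → ZMod 5 :=
  ![v 1 * v 2, v 0 * v 2, v 0 * v 1]

/-- The values of the conics through the unit point and all coordinate points but the `k`-th. -/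
def unitTerms (k : Fin 3) (v : Fin 3 → ZMod 5) : Fin 3 → ZMod 5 :=
  ![v k ^ 2 - v 0 * v 1, v 1 * v 2 - v 0 * v 1, v 0 * v 2 - v 0 * v 1]

/-- Vanishes when three points lie on a common conic with the three coordinate points. -/
def coordDet (u v w : Fin 3 → ZMod 5) : ZMod 5 :=
  tripleDet (crossTerms u) (crossTerms v) (crossTerms w)

/-- Vanishes when three points lie on a common conic with the unit point and the coordinate points
other than the `k`-th. -/
def unitDet (k : Fin 3) (u v w : Fin 3 → ZMod 5) : ZMod 5 :=
  tripleDet (unitTerms k u) (unitTerms k v) (unitTerms k w)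

/-- Vanishes when four points lie on a common conic with the coordinate points other than the
`k`-th. -/
def squareDet (k : Fin 3) (u v w x : Fin 3 → ZMod 5) : ZMod 5 :=
  u k ^ 2 * coordDet v w x - v k ^ 2 * coordDet u w x + w k ^ 2 * coordDet u v x -
    x k ^ 2 * coordDet u v w

/-- The conditions on two points of a generalized arc containing the standard frame. -/
def GoodPair (p q : Fin 31) : Prop := frameDet (planePoint p) (planePoint q) ≠ 0

/-- The conditions on three points of a generalized arc containing the standard frame. -/
def GoodTriple (p q r : Fin 31) : Prop :=
  coordDet (planePoint p) (planePoint q) (planePoint r) ≠ 0 ∧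
    ∀ k, unitDet k (planePoint p) (planePoint q) (planePoint r) ≠ 0

instance : DecidableRel GoodPair := fun _ _ => inferInstanceAs (Decidable (_ ≠ _))

instance (p q r : Fin 31) : Decidable (GoodTriple p q r) := inferInstanceAs (Decidable (_ ∧ _))

set_option synthInstance.maxHeartbeats 400000 in
set_option synthInstance.maxSize 2000 in
theorem exists_squareDet_eq_zero : ∀ p q : Fin 31, p < q → GoodPair p q →
    ∀ r, q < r → GoodPair p r → GoodPair q r → GoodTriple p q r →
    ∀ s, r < s → GoodPair p s → GoodPair q s → GoodPair r s → GoodTriple p q s →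
      GoodTriple p r s → GoodTriple q r s →
    ∃ k, squareDet k (planePoint p) (planePoint q) (planePoint r) (planePoint s) = 0 := by
  decide +kernel

/-- Conics spanning those through the standard frame. -/
def frameForms : Fin 2 → Fin 6 → ZMod 5 := ![![0, 0, 0, 1, 0, -1], ![0, 0, 0, 0, 1, -1]]

/-- Conics spanning those through the three coordinate points. -/
def crossForms : Fin 3 → Fin 6 → ZMod 5 :=
  ![![0, 0, 0, 1, 0, 0], ![0, 0, 0, 0, 1, 0], ![0, 0, 0, 0, 0, 1]]

/-- Conics spanning those through the unit point and all coordinate points but the `k`-th. -/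
def unitForms (k : Fin 3) : Fin 3 → Fin 6 → ZMod 5 :=
  Matrix.vecCons
    ![if k = 0 then 1 else 0, if k = 1 then 1 else 0, if k = 2 then 1 else 0, 0, 0, -1] frameForms

/-- Conics spanning those through all coordinate points but the `k`-th. -/
def squareForms (k : Fin 3) : Fin 4 → Fin 6 → ZMod 5 :=
  Matrix.vecCons
    ![if k = 0 then 1 else 0, if k = 1 then 1 else 0, if k = 2 then 1 else 0, 0, 0, 0] crossForms

theorem frameForms_independent (w : Fin 2 → ZMod 5) (h : ∑ j, w j • frameForms j = 0) : w = 0 := by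
  have h3 := congrFun h 3
  have h4 := congrFun h 4
  simp [Fin.sum_univ_succ, frameForms] at h3 h4
  ext j
  fin_cases j <;> simp [*]

theorem crossForms_independent (w : Fin 3 → ZMod 5) (h : ∑ j, w j • crossForms j = 0) : w = 0 := by
  have h3 := congrFun h 3
  have h4 := congrFun h 4
  have h5 := congrFun h 5
  simp [Fin.sum_univ_succ, crossForms] at h3 h4 h5
  ext j
  fin_cases j <;> simp [*]

theorem unitForms_independent (k : Fin 3) (w : Fin 3 → ZMod 5)
    (h : ∑ j, w j • unitForms k j = 0) : w = 0 := by
  have hk := congrFun h (k.castLE (by decide))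
  have h3 := congrFun h 3
  have h4 := congrFun h 4
  fin_cases k <;> simp [Fin.sum_univ_succ, unitForms, frameForms] at hk h3 h4 <;> ext j <;>
    fin_cases j <;> simp [*]

theorem squareForms_independent (k : Fin 3) (w : Fin 4 → ZMod 5)
    (h : ∑ j, w j • squareForms k j = 0) : w = 0 := by
  have hk := congrFun h (k.castLE (by decide))
  have h3 := congrFun h 3
  have h4 := congrFun h 4
  have h5 := congrFun h 5
  fin_cases k <;> simp [Fin.sum_univ_succ, squareForms, crossForms] at hk h3 h4 h5 <;> ext j <;>
    fin_cases j <;> simp [*]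

theorem ternaryForm_crossForms (j : Fin 3) (v : Fin 3 → ZMod 5) :
    ternaryForm (crossForms j) v = crossTerms v j := by
  fin_cases j <;> simp [ternaryForm_apply, crossForms, crossTerms]

theorem ternaryForm_unitForms (k j : Fin 3) (v : Fin 3 → ZMod 5) :
    ternaryForm (unitForms k j) v = unitTerms k v j := by
  fin_cases j <;> fin_cases k <;>
    simp [ternaryForm_apply, unitForms, frameForms, unitTerms, sub_eq_add_neg]

theorem ternaryForm_squareForms_zero (k : Fin 3) (v : Fin 3 → ZMod 5) :
    ternaryForm (squareForms k 0) v = v k ^ 2 := by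
  fin_cases k <;> simp [ternaryForm_apply, squareForms]

theorem ternaryForm_squareForms_succ (k j : Fin 3) (v : Fin 3 → ZMod 5) :
    ternaryForm (squareForms k j.succ) v = crossTerms v j :=
  ternaryForm_crossForms j v

theorem det_frameForms (x : Fin 2 → Fin 3 → ZMod 5) :
    (Matrix.of fun i j => ternaryForm (frameForms j) (x i)).det = frameDet (x 0) (x 1) := by
  rw [Matrix.det_fin_two]
  simp [ternaryForm_apply, frameForms, frameDet]
  ring

theorem det_of_eq_tripleDet (x : Fin 3 → Fin 3 → ZMod 5) :
    (Matrix.of x).det = tripleDet (x 0) (x 1) (x 2) := by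
  rw [Matrix.det_fin_three]
  simp only [Matrix.of_apply, tripleDet]
  ring

theorem det_crossForms (x : Fin 3 → Fin 3 → ZMod 5) :
    (Matrix.of fun i j => ternaryForm (crossForms j) (x i)).det =
      coordDet (x 0) (x 1) (x 2) := by
  simp only [ternaryForm_crossForms]
  exact det_of_eq_tripleDet _

theorem det_unitForms (k : Fin 3) (x : Fin 3 → Fin 3 → ZMod 5) :
    (Matrix.of fun i j => ternaryForm (unitForms k j) (x i)).det =
      unitDet k (x 0) (x 1) (x 2) := by
  simp only [ternaryForm_unitForms]
  exact det_of_eq_tripleDet _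

theorem det_squareForms (k : Fin 3) (x : Fin 4 → Fin 3 → ZMod 5) :
    (Matrix.of fun i j => ternaryForm (squareForms k j) (x i)).det =
      squareDet k (x 0) (x 1) (x 2) (x 3) := by
  have hminor (i : Fin 4) : (((Matrix.of fun i j => ternaryForm (squareForms k j) (x i)).submatrix
      i.succAbove Fin.succ).det) = coordDet (x (i.succAbove 0)) (x (i.succAbove 1))
        (x (i.succAbove 2)) := by
    rw [coordDet, ← det_of_eq_tripleDet fun l => crossTerms (x (i.succAbove l))]
    congr 1
    ext l j
    simp [ternaryForm_squareForms_succ]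
  rw [Matrix.det_succ_column_zero]
  simp only [hminor, Matrix.of_apply, ternaryForm_squareForms_zero, Fin.sum_univ_four]
  simp [squareDet, Fin.succAbove]
  ring

theorem det_ternaryForm_ne_zero {N B : Finset (Fin 31)}
    (hN : ∀ c : Fin 6 → ZMod 5, c ≠ 0 →
      (N.filter fun n => ternaryForm c (planePoint n) = 0).card ≤ 5)
    (hBN : B ⊆ N) {m : ℕ} (hB : B.card + m = 6) {t : Fin m → Fin 31} (ht : Function.Injective t)
    (htN : ∀ i, t i ∈ N \ B) (forms : Fin m → Fin 6 → ZMod 5)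
    (hforms : ∀ w : Fin m → ZMod 5, ∑ j, w j • forms j = 0 → w = 0)
    (hvanish : ∀ n ∈ B, ∀ j, ternaryForm (forms j) (planePoint n) = 0) :
    (Matrix.of fun i j => ternaryForm (forms j) (planePoint (t i))).det ≠ 0 := by
  intro hdet
  obtain ⟨w, hw, hMw⟩ := Matrix.exists_mulVec_eq_zero_iff.mpr hdet
  have hc : ∑ j, w j • forms j ≠ 0 := fun h => hw (hforms w h)
  have hdisj : Disjoint B (Finset.univ.image t) := by
    rw [Finset.disjoint_right]
    intro n hn
    obtain ⟨i, -, rfl⟩ := Finset.mem_image.mp hn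
    exact (Finset.mem_sdiff.mp (htN i)).2
  have hsub : B ∪ Finset.univ.image t ⊆
      N.filter fun n => ternaryForm (∑ j, w j • forms j) (planePoint n) = 0 := by
    intro n hn
    rw [Finset.mem_filter, ternaryForm_sum]
    rcases Finset.mem_union.mp hn with hn | hn
    · exact ⟨hBN hn, Finset.sum_eq_zero fun j _ => by rw [hvanish n hn, mul_zero]⟩
    · obtain ⟨i, -, rfl⟩ := Finset.mem_image.mp hn
      refine ⟨(Finset.mem_sdiff.mp (htN i)).1, ?_⟩
      simpa [Matrix.mulVec, dotProduct, mul_comm] using congrFun hMw i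
  have := (Finset.card_le_card hsub).trans (hN _ hc)
  rw [Finset.card_union_of_disjoint hdisj, Finset.card_image_of_injective _ ht,
    Finset.card_univ, Fintype.card_fin] at this
  omega

theorem card_le_seven_of_frame_subset {N : Finset (Fin 31)} (hframe : {0, 6, 25, 30} ⊆ N)
    (hN : ∀ c : Fin 6 → ZMod 5, c ≠ 0 →
      (N.filter fun n => ternaryForm c (planePoint n) = 0).card ≤ 5) : N.card ≤ 7 := by
  by_contra! hcard
  have hcard' : 4 ≤ (N \ {0, 6, 25, 30}).card := by
    rw [Finset.card_sdiff_of_subset hframe]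
    have : ({0, 6, 25, 30} : Finset (Fin 31)).card = 4 := by decide
    omega
  obtain ⟨T, hT, hT4⟩ := Finset.exists_subset_card_eq hcard'
  let t := T.orderEmbOfFin hT4
  have htN {B : Finset (Fin 31)} (hB : B ⊆ {0, 6, 25, 30}) {m : ℕ} (σ : Fin m → Fin 4)
      (i : Fin m) : t (σ i) ∈ N \ B :=
    Finset.sdiff_subset_sdiff subset_rfl hB (hT (T.orderEmbOfFin_mem hT4 _))
  have key {m : ℕ} (B : Finset (Fin 31)) (forms : Fin m → Fin 6 → ZMod 5) (hB : B.card + m = 6)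
      (hBf : B ⊆ {0, 6, 25, 30}) (hforms : ∀ w : Fin m → ZMod 5, ∑ j, w j • forms j = 0 → w = 0)
      (hvanish : ∀ n ∈ B, ∀ j, ternaryForm (forms j) (planePoint n) = 0)
      (σ : Fin m → Fin 4) (hσ : Function.Injective σ) :
      (Matrix.of fun i j => ternaryForm (forms j) (planePoint (t (σ i)))).det ≠ 0 :=
    det_ternaryForm_ne_zero hN (hBf.trans hframe) hB (t.injective.comp hσ) (htN hBf σ) forms
      hforms hvanish
  have hpair (σ : Fin 2 → Fin 4) (hσ : Function.Injective σ) :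
      GoodPair (t (σ 0)) (t (σ 1)) := by
    have h := key {0, 6, 25, 30} frameForms (by decide) (by decide) frameForms_independent
      (by decide) σ hσ
    rwa [det_frameForms] at h
  have hcoord (σ : Fin 3 → Fin 4) (hσ : Function.Injective σ) :
      coordDet (planePoint (t (σ 0))) (planePoint (t (σ 1))) (planePoint (t (σ 2))) ≠ 0 := by
    have h := key {0, 25, 30} crossForms (by decide) (by decide) crossForms_independent
      (by decide) σ hσ
    rwa [det_crossForms] at h
  have hunit (k : Fin 3) (σ : Fin 3 → Fin 4) (hσ : Function.Injective σ) :
      unitDet k (planePoint (t (σ 0))) (planePoint (t (σ 1))) (planePoint (t (σ 2))) ≠ 0 := by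
    have h := key (({0, 6, 25, 30} : Finset (Fin 31)).erase (![0, 25, 30] k)) (unitForms k)
      (by decide +revert) (Finset.erase_subset _ _) (unitForms_independent k)
      (by clear! N; decide +revert) σ hσ
    rwa [det_unitForms] at h
  have hsquare (k : Fin 3) : squareDet k (planePoint (t 0)) (planePoint (t 1)) (planePoint (t 2))
      (planePoint (t 3)) ≠ 0 := by
    have h := key (({0, 25, 30} : Finset (Fin 31)).erase (![0, 25, 30] k)) (squareForms k)
      (by decide +revert) ((Finset.erase_subset _ _).trans (by decide)) (squareForms_independent k)
      (by clear! N; decide +revert) id Function.injective_id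
    rwa [det_squareForms] at h
  have htriple (σ : Fin 3 → Fin 4) (hσ : Function.Injective σ) :
      GoodTriple (t (σ 0)) (t (σ 1)) (t (σ 2)) := ⟨hcoord σ hσ, fun k => hunit k σ hσ⟩
  have hlt {i j : Fin 4} (h : i < j) : t i < t j := t.strictMono h
  obtain ⟨k, hk⟩ := exists_squareDet_eq_zero (t 0) (t 1) (hlt (by decide))
    (hpair ![0, 1] (by decide)) (t 2) (hlt (by decide)) (hpair ![0, 2] (by decide))
    (hpair ![1, 2] (by decide)) (htriple ![0, 1, 2] (by decide)) (t 3) (hlt (by decide))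
    (hpair ![0, 3] (by decide)) (hpair ![1, 3] (by decide)) (hpair ![2, 3] (by decide))
    (htriple ![0, 1, 3] (by decide)) (htriple ![0, 2, 3] (by decide))
    (htriple ![1, 2, 3] (by decide))
  exact hsquare k hk

theorem exists_smul_eq_planePoint {v : Fin 3 → ZMod 5} (hv : v ≠ 0) :
    ∃ (n : Fin 31) (t : ZMod 5), t ≠ 0 ∧ t • v = planePoint n := by
  have h1 : ∀ a b : ZMod 5, ∃ n, ![1, a, b] = planePoint n := by decide +kernel
  have h2 : ∀ b : ZMod 5, ∃ n, ![0, 1, b] = planePoint n := by decide +kernel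
  by_cases h0 : v 0 = 0
  · by_cases h0' : v 1 = 0
    · have h0'' : v 2 ≠ 0 := fun h => hv (by ext i; fin_cases i <;> assumption)
      refine ⟨30, (v 2)⁻¹, inv_ne_zero h0'', ?_⟩
      ext i
      fin_cases i <;> simp [h0, h0', h0'', planePoint]
    · obtain ⟨n, hn⟩ := h2 ((v 1)⁻¹ * v 2)
      refine ⟨n, (v 1)⁻¹, inv_ne_zero h0', ?_⟩
      rw [← hn]
      ext i
      fin_cases i <;> simp [h0, h0']
  · obtain ⟨n, hn⟩ := h1 ((v 0)⁻¹ * v 1) ((v 0)⁻¹ * v 2)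
    refine ⟨n, (v 0)⁻¹, inv_ne_zero h0, ?_⟩
    rw [← hn]
    ext i
    fin_cases i <;> simp [h0]

theorem planePoint_eq_of_smul_eq {m n : Fin 31} {t : ZMod 5} (ht : t ≠ 0)
    (h : t • planePoint m = planePoint n) : m = n := by
  revert m n t
  decide +kernel

theorem IsGenArc.card_le_seven {S : Finset (P2 (ZMod 5))}
    (hS : IsGenArc (S : Set (P2 (ZMod 5)))) : S.card ≤ 7 := by
  by_contra! hcard
  obtain ⟨g, hg, p₁, hp₁, hg₁⟩ := hS.exists_frame hcard
  have hne (p : P2 (ZMod 5)) : g p.rep ≠ 0 := by simpa using p.rep_nonzero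
  choose n t ht hnt using fun p : P2 (ZMod 5) => exists_smul_eq_planePoint (hne p)
  have hn : Function.Injective n := by
    intro p q hpq
    have h : t p • p.rep = t q • q.rep := by
      apply g.injective
      rw [map_smul, map_smul, hnt, hnt, hpq]
    rw [← p.mk_rep, ← q.mk_rep, Projectivization.mk_eq_mk_iff']
    exact ⟨(t p)⁻¹ * t q, by rw [mul_smul, ← h, inv_smul_smul₀ (ht p)]⟩
  have hn_eq {p : P2 (ZMod 5)} {m : Fin 31} {s : ZMod 5} (hs : s ≠ 0)
      (h : s • g p.rep = planePoint m) : n p = m := by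
    refine planePoint_eq_of_smul_eq (t := s * (t p)⁻¹) (mul_ne_zero hs (inv_ne_zero (ht p))) ?_
    rw [← hnt, mul_smul, inv_smul_smul₀ (ht p), h]
  have hcoord (i : Fin 3) (m : Fin 31) (h : Pi.single i 1 = planePoint m) : m ∈ S.image n := by
    obtain ⟨p, hp, s, hs, hsp⟩ := hg i
    exact Finset.mem_image.mpr ⟨p, hp, hn_eq hs (hsp.trans h)⟩
  have hframe : {0, 6, 25, 30} ⊆ S.image n := by
    intro m hm
    simp only [Finset.mem_insert, Finset.mem_singleton] at hm
    rcases hm with rfl | rfl | rfl | rfl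
    · exact hcoord 0 _ (by decide)
    · exact Finset.mem_image.mpr ⟨p₁, hp₁, hn_eq one_ne_zero (by rw [hg₁]; decide)⟩
    · exact hcoord 1 _ (by decide)
    · exact hcoord 2 _ (by decide)
  have := card_le_seven_of_frame_subset hframe fun c hc => by
    obtain ⟨v, hv⟩ := exists_ternaryForm_ne_zero hc
    refine le_trans (le_of_eq ?_) (hS.card_filter_le g.toLinearMap c ⟨g.symm v, by simpa using hv⟩)
    rw [Finset.filter_image, Finset.card_image_of_injective _ hn]
    congr 1
    ext p
    simp [← hnt, ternaryForm_smul, ht]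
  rw [Finset.card_image_of_injective _ hn] at this
  omega

/-- Representatives of the vertices and the diagonal points of a complete quadrangle. -/
def quadranglePoint : Fin 7 → Fin 3 → ZMod 5 :=
  ![![1, 0, 0], ![0, 1, 0], ![0, 0, 1], ![1, 1, 1], ![0, 1, 1], ![1, 0, 1], ![1, 1, 0]]

theorem quadranglePoint_ne_zero : ∀ i, quadranglePoint i ≠ 0 := by decide

/-- The vertices and the diagonal points of a complete quadrangle. -/
def quadrangle (i : Fin 7) : P2 (ZMod 5) :=
  Projectivization.mk _ (quadranglePoint i) (quadranglePoint_ne_zero i)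

theorem quadrangle_injective : Function.Injective quadrangle := by
  intro i j h
  rw [quadrangle, quadrangle, Projectivization.mk_eq_mk_iff'] at h
  revert i j
  decide

theorem card_filter_quadranglePoint_le {c : Fin 6 → ZMod 5} (hc : c ≠ 0) :
    (Finset.univ.filter fun i => ternaryForm c (quadranglePoint i) = 0).card ≤ 5 := by
  by_contra! h
  set q : Fin 7 → ZMod 5 := fun i => ternaryForm c (quadranglePoint i) with hq
  have hrel : q 0 + q 1 + q 2 + q 3 = q 4 + q 5 + q 6 := by
    simp [hq, ternaryForm_apply, quadranglePoint]
    ring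
  have hcompl : (Finset.univ.filter fun i => q i ≠ 0).card ≤ 1 := by
    have := Finset.card_filter_add_card_filter_not (s := Finset.univ) (fun i => q i = 0)
    rw [Finset.card_univ, Fintype.card_fin] at this
    change (Finset.univ.filter fun i => ¬q i = 0).card ≤ 1
    change 5 < (Finset.univ.filter fun i => q i = 0).card at h
    omega
  have hzero : ∀ i, q i = 0 := by
    by_contra! ⟨i, hi⟩
    have hother (j : Fin 7) (hj : j ≠ i) : q j = 0 := by
      by_contra hj0
      exact hj (Finset.card_le_one.mp hcompl j (by simpa using hj0) i (by simpa using hi))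
    refine hi ?_
    fin_cases i <;> simp [hother] at hrel ⊢ <;> first | exact hrel | exact hrel.symm
  refine hc ?_
  have h0 := hzero 0
  have h1 := hzero 1
  have h2 := hzero 2
  have h3 := hzero 4
  have h4 := hzero 5
  have h5 := hzero 6
  simp [hq, ternaryForm_apply, quadranglePoint] at h0 h1 h2 h3 h4 h5
  simp only [h0, h1, h2, zero_add] at h3 h4 h5
  ext i
  fin_cases i <;> simp [*]

theorem isGenArc_range_quadrangle : IsGenArc (Set.range quadrangle) := by
  rintro _ ⟨Q, hQ0, hQ, rfl⟩
  obtain ⟨c, hc, hQc⟩ := exists_eval_eq_ternaryForm hQ hQ0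
  have hset : Set.range quadrangle ∩ {p | MvPolynomial.eval p.rep Q = 0} =
      (((Finset.univ.filter fun i => ternaryForm c (quadranglePoint i) = 0).map
        ⟨quadrangle, quadrangle_injective⟩ : Finset (P2 (ZMod 5))) : Set (P2 (ZMod 5))) := by
    have hiff (i : Fin 7) : MvPolynomial.eval (quadrangle i).rep Q = 0 ↔
        ternaryForm c (quadranglePoint i) = 0 := by
      obtain ⟨a, ha⟩ := Projectivization.exists_smul_eq_mk_rep (ZMod 5) (quadranglePoint i)
        (quadranglePoint_ne_zero i)
      rw [quadrangle, ← ha, hQc, Units.smul_def, ternaryForm_smul]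
      simp
    ext p
    constructor
    · rintro ⟨⟨i, rfl⟩, hi⟩
      simpa [quadrangle_injective.eq_iff, ← hiff] using hi
    · intro hp
      obtain ⟨i, hi, rfl⟩ := Finset.mem_map.mp (Finset.mem_coe.mp hp)
      exact ⟨⟨i, rfl⟩, (hiff i).mpr (Finset.mem_filter.mp hi).2⟩
  rw [hset, Set.ncard_coe_finset, Finset.card_map]
  exact card_filter_quadranglePoint_le hc

/-- every generalized `k`-arc in `P²(F₅)` satisfies `k ≤ 7`;
hence `m_g(2,5) = 7`. -/
theorem stmt8 :
    (∀ (k : ℕ) (K : Set (P2 (ZMod 5))), K.ncard = k → IsGenArc K → k ≤ 7) ∧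
    IsGreatest {k : ℕ | ∃ K : Set (P2 (ZMod 5)), K.ncard = k ∧ IsGenArc K} 7 := by
  have hle (k : ℕ) (K : Set (P2 (ZMod 5))) (hk : K.ncard = k) (hK : IsGenArc K) : k ≤ 7 := by
    rcases K.finite_or_infinite with hfin | hinf
    · obtain ⟨S, rfl⟩ := hfin.exists_finset_coe
      rw [← hk, Set.ncard_coe_finset]
      exact hK.card_le_seven
    · rw [← hk, hinf.ncard]
      exact Nat.zero_le _
  refine ⟨hle, ⟨Set.range quadrangle, ?_, isGenArc_range_quadrangle⟩, ?_⟩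
  · rw [← Set.image_univ, Set.ncard_image_of_injective _ quadrangle_injective, Set.ncard_univ,
      Nat.card_fin]
  · rintro k ⟨K, hk, hK⟩
    exact hle k K hk hK
end

section
/- Let F be a finite field with q elements where q ≥ 7 is odd. Then every generalized k-arc in P²(F) satisfies k ≤ q − (√q)/4 + 19/4. -/
section GeneralizedArcBound

open MvPolynomial

/-- `h` is the evaluation function of a plane polynomial of total degree at most `d`. -/
def PolyFun {L : Type*} [Field L] (d : ℕ) (h : (Fin 2 → L) → L) : Prop :=
  ∃ p : MvPolynomial (Fin 2) L, p.totalDegree ≤ d ∧ ∀ Y, h Y = eval Y p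

namespace PolyFun

variable {L : Type*} [Field L] {d e : ℕ} {h k : (Fin 2 → L) → L}

theorem of_poly {p : MvPolynomial (Fin 2) L} (hp : p.totalDegree ≤ d) :
    PolyFun d fun Y => eval Y p := ⟨p, hp, fun _ => rfl⟩

theorem mono (hh : PolyFun d h) (hde : d ≤ e) : PolyFun e h :=
  let ⟨p, hp, H⟩ := hh; ⟨p, hp.trans hde, H⟩

theorem const (c : L) : PolyFun d fun _ : Fin 2 → L => c :=
  ⟨C c, by simp, by simp⟩

theorem coord (i : Fin 2) : PolyFun 1 fun Y : Fin 2 → L => Y i :=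
  ⟨X i, by simp, by simp⟩

theorem add (hh : PolyFun d h) (hk : PolyFun d k) : PolyFun d fun Y => h Y + k Y := by
  obtain ⟨p, hp, H⟩ := hh
  obtain ⟨r, hr, K⟩ := hk
  exact ⟨p + r, (totalDegree_add p r).trans (max_le hp hr), fun Y => by simp [H, K]⟩

theorem mul (hh : PolyFun d h) (hk : PolyFun e k) : PolyFun (d + e) fun Y => h Y * k Y := by
  obtain ⟨p, hp, H⟩ := hh
  obtain ⟨r, hr, K⟩ := hk
  exact ⟨p * r, (totalDegree_mul p r).trans (add_le_add hp hr), fun Y => by simp [H, K]⟩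

theorem const_mul (c : L) (hh : PolyFun d h) : PolyFun d fun Y => c * h Y := by
  simpa using (const (d := 0) c).mul hh

theorem sub (hh : PolyFun d h) (hk : PolyFun d k) : PolyFun d fun Y => h Y - k Y := by
  simpa [sub_eq_add_neg] using hh.add (hk.const_mul (-1))

theorem sum {ι : Type*} (s : Finset ι) {h : ι → (Fin 2 → L) → L}
    (H : ∀ i ∈ s, PolyFun d (h i)) : PolyFun d fun Y => ∑ i ∈ s, h i Y := by
  classical
  induction s using Finset.induction_on with
  | empty => simpa using const 0
  | insert a s ha ih =>
    simp only [Finset.sum_insert ha]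
    exact (H a (by simp)).add (ih fun i hi => H i (by simp [hi]))

theorem pow (hh : PolyFun d h) (n : ℕ) : PolyFun (n * d) fun Y => h Y ^ n := by
  obtain ⟨p, hp, H⟩ := hh
  exact ⟨p ^ n, (totalDegree_pow p n).trans (Nat.mul_le_mul_left n hp), fun Y => by simp [H]⟩

theorem comp {p : MvPolynomial (Fin 2) L} (hp : p.totalDegree ≤ d)
    {a : (Fin 2 → L) → Fin 2 → L} (ha : ∀ i, PolyFun 1 fun Y => a Y i) :
    PolyFun d fun Y => eval (a Y) p := by
  simp only [eval_eq']
  refine sum _ fun m hm => const_mul _ ?_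
  simp only [Fin.prod_univ_two]
  refine (((ha 0).pow _).mul ((ha 1).pow _)).mono ?_
  have := (le_totalDegree hm).trans hp
  rw [Finsupp.sum_fintype _ _ (by simp)] at this
  simpa using this

theorem congr_const (hh : PolyFun 0 h) (Y Z : Fin 2 → L) : h Y = h Z := by
  obtain ⟨p, hp, H⟩ := hh
  rw [H, H, totalDegree_eq_zero_iff_eq_C.1 (Nat.le_zero.1 hp)]
  simp

end PolyFun

/-- The univariate polynomials `P Y` have degree at most `d`, and their coefficients of order `n`
are polynomials of degree at most `d - n` in `Y`. -/
def PolyFamily {L : Type*} [Field L] (d : ℕ) (P : (Fin 2 → L) → Polynomial L) : Prop :=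
  (∀ Y, (P Y).natDegree ≤ d) ∧ ∀ n ≤ d, PolyFun (d - n) fun Y => (P Y).coeff n

namespace PolyFamily

variable {L : Type*} [Field L] {d e : ℕ} {P R : (Fin 2 → L) → Polynomial L}

theorem mono (hP : PolyFamily d P) (hde : d ≤ e) : PolyFamily e P := by
  refine ⟨fun Y => (hP.1 Y).trans hde, fun n hn => ?_⟩
  by_cases h : n ≤ d
  · exact (hP.2 n h).mono (by omega)
  · have : (fun Y => (P Y).coeff n) = fun _ => 0 :=
      funext fun Y => Polynomial.coeff_eq_zero_of_natDegree_lt (lt_of_le_of_lt (hP.1 Y) (by omega))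
    exact this ▸ PolyFun.const 0

theorem add (hP : PolyFamily d P) (hR : PolyFamily d R) : PolyFamily d fun Y => P Y + R Y :=
  ⟨fun Y => Polynomial.natDegree_add_le_of_degree_le (hP.1 Y) (hR.1 Y), fun n hn => by
    simpa using (hP.2 n hn).add (hR.2 n hn)⟩

theorem C_apply {h : (Fin 2 → L) → L} (hh : PolyFun d h) :
    PolyFamily d fun Y => Polynomial.C (h Y) := by
  refine ⟨fun Y => by simp, fun n _ => ?_⟩
  rcases n with _ | n
  · simpa using hh
  · simpa [Polynomial.coeff_C] using PolyFun.const 0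

theorem mul (hP : PolyFamily d P) (hR : PolyFamily e R) :
    PolyFamily (d + e) fun Y => P Y * R Y := by
  refine ⟨fun Y => Polynomial.natDegree_mul_le_of_le (hP.1 Y) (hR.1 Y), fun n hn => ?_⟩
  simp only [Polynomial.coeff_mul]
  refine PolyFun.sum _ fun x hx => ?_
  rw [Finset.HasAntidiagonal.mem_antidiagonal] at hx
  by_cases h1 : x.1 ≤ d
  · by_cases h2 : x.2 ≤ e
    · exact ((hP.2 _ h1).mul (hR.2 _ h2)).mono (by omega)
    · have : (fun Y => (P Y).coeff x.1 * (R Y).coeff x.2) = fun _ => 0 := funext fun Y => by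
        rw [Polynomial.coeff_eq_zero_of_natDegree_lt (lt_of_le_of_lt (hR.1 Y) (by omega)), mul_zero]
      exact this ▸ PolyFun.const 0
  · have : (fun Y => (P Y).coeff x.1 * (R Y).coeff x.2) = fun _ => 0 := funext fun Y => by
      rw [Polynomial.coeff_eq_zero_of_natDegree_lt (lt_of_le_of_lt (hP.1 Y) (by omega)), zero_mul]
    exact this ▸ PolyFun.const 0

theorem pow (hP : PolyFamily d P) (n : ℕ) : PolyFamily (n * d) fun Y => P Y ^ n := by
  induction n with
  | zero => simpa using C_apply (PolyFun.const (d := 0 * d) (1 : L))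
  | succ n ih => simpa [pow_succ, Nat.succ_mul] using ih.mul hP

theorem sum {ι : Type*} (s : Finset ι) {P : ι → (Fin 2 → L) → Polynomial L}
    (H : ∀ i ∈ s, PolyFamily d (P i)) : PolyFamily d fun Y => ∑ i ∈ s, P i Y := by
  classical
  induction s using Finset.induction_on with
  | empty => simpa using C_apply (PolyFun.const (d := d) (0 : L))
  | insert a s ha ih =>
    simp only [Finset.sum_insert ha]
    exact (H a (by simp)).add (ih fun i hi => H i (by simp [hi]))

end PolyFamily

/-- The restriction `s ↦ p (Y + s v)` of a plane polynomial to a line. -/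
noncomputable def lineRestrict {L : Type*} [Field L] (v : Fin 2 → L)
    (p : MvPolynomial (Fin 2) L) (Y : Fin 2 → L) : Polynomial L :=
  aeval (fun i => Polynomial.C (Y i) + Polynomial.C (v i) * Polynomial.X) p

section lineRestrict

variable {L : Type*} [Field L] (v : Fin 2 → L) (p : MvPolynomial (Fin 2) L)

theorem eval_lineRestrict (Y : Fin 2 → L) (s : L) :
    (lineRestrict v p Y).eval s = eval (Y + s • v) p := by
  induction p using MvPolynomial.induction_on with
  | C a => simp [lineRestrict]
  | add p r hp hr => simp_all [lineRestrict]
  | mul_X p i hp =>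
    simp only [lineRestrict, map_mul, Polynomial.eval_mul, aeval_X] at *
    simp only [hp, Polynomial.eval_add, Polynomial.eval_mul, Polynomial.eval_C, Polynomial.eval_X,
      eval_X, Pi.add_apply, Pi.smul_apply, smul_eq_mul, mul_comm s]

theorem polyFamily_lineRestrict {d : ℕ} (hp : p.totalDegree ≤ d) :
    PolyFamily d (lineRestrict v p) := by
  have hl : ∀ i, PolyFamily 1 fun Y : Fin 2 → L =>
      Polynomial.C (Y i) + Polynomial.C (v i) * Polynomial.X := fun i => by
    refine (PolyFamily.C_apply (PolyFun.coord i)).add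
      ⟨fun Y => by simpa using Polynomial.natDegree_C_mul_X_pow_le (v i) 1,
        fun n _ => PolyFun.const _⟩
  have : lineRestrict v p = fun Y => ∑ m ∈ p.support, Polynomial.C (coeff m p) *
      ((Polynomial.C (Y 0) + Polynomial.C (v 0) * Polynomial.X) ^ m 0 *
       (Polynomial.C (Y 1) + Polynomial.C (v 1) * Polynomial.X) ^ m 1) := by
    funext Y
    rw [lineRestrict, aeval_def, eval₂_eq']
    simp [Fin.prod_univ_two]
  rw [this]
  refine PolyFamily.sum _ fun m hm => ?_
  refine ((PolyFamily.C_apply (PolyFun.const (d := 0) _)).mul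
    (((hl 0).pow _).mul ((hl 1).pow _))).mono ?_
  have := (le_totalDegree hm).trans hp
  rw [Finsupp.sum_fintype _ _ (by simp)] at this
  simpa using this

theorem coeff_lineRestrict_zero (n : ℕ) :
    (lineRestrict v p 0).coeff n = eval v (homogeneousComponent n p) := by
  rw [lineRestrict, aeval_def, eval₂_eq', homogeneousComponent_apply]
  simp only [Pi.zero_apply, map_zero, zero_add, Polynomial.algebraMap_eq, map_sum,
    Polynomial.finsetSum_coeff, Finset.sum_filter]
  refine Finset.sum_congr rfl fun m _ => ?_
  simp only [mul_pow, Finset.prod_mul_distrib, ← Polynomial.C_pow, Finset.prod_pow_eq_pow_sum,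
    ← map_prod, Polynomial.coeff_C_mul, Polynomial.coeff_X_pow]
  have : m.degree = ∑ i, m i := Finsupp.degree_eq_sum m
  by_cases h : m.degree = n
  · simp [h, ← this, eval_monomial, Finsupp.prod_fintype]
  · simp [h, ← this, Ne.symm h]

theorem coeff_lineRestrict_top {d : ℕ} (hp : p.totalDegree ≤ d) (Y : Fin 2 → L) :
    (lineRestrict v p Y).coeff d = eval v (homogeneousComponent d p) := by
  rw [← coeff_lineRestrict_zero]
  have := (polyFamily_lineRestrict v p hp).2 d le_rfl
  rw [Nat.sub_self] at this
  exact this.congr_const Y 0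

theorem derivative_lineRestrict (Y : Fin 2 → L) :
    (lineRestrict v p Y).derivative = lineRestrict v (∑ i, C (v i) * pderiv i p) Y := by
  induction p using MvPolynomial.induction_on with
  | C a => simp [lineRestrict]
  | add p r hp hr =>
    simp only [lineRestrict, map_add, mul_add, Finset.sum_add_distrib] at *
    rw [hp, hr]
  | mul_X p i hp =>
    simp only [lineRestrict, map_mul, Derivation.leibniz, Polynomial.derivative_mul,
      aeval_X, aeval_C, map_add, smul_eq_mul, pderiv_X, Fin.sum_univ_two] at *
    rw [hp]
    fin_cases i <;> simp <;> ring

end lineRestrict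

section Bezout

variable {L : Type*} [Field L]

theorem two_mul_finrank_restrictTotalDegree (d : ℕ) :
    2 * Module.finrank L (restrictTotalDegree (Fin 2) L d) = (d + 1) * (d + 2) := by
  have hcard : Nat.card {n : Fin 2 →₀ ℕ | (n.sum fun _ e => e) ≤ d}
      = ∑ i ∈ Finset.range (d + 1), (i + 1) := by
    let e : {n : Fin 2 →₀ ℕ // (n.sum fun _ e => e) ≤ d} ≃ {x : ℕ × ℕ // x.1 + x.2 ≤ d} :=
      (Finsupp.equivFunOnFinite.trans (finTwoArrowEquiv ℕ)).subtypeEquiv fun n => by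
        rw [Finsupp.sum_fintype _ _ (by simp)]; simp
    rw [Set.coe_ofPred, Nat.card_congr e,
      Nat.subtype_card ((Finset.range (d + 1)).biUnion Finset.HasAntidiagonal.antidiagonal)
        (by simp)]
    rw [Finset.card_biUnion fun i _ j _ hij => Finset.disjoint_left.2 fun x hx hx' => hij
      ((Finset.HasAntidiagonal.mem_antidiagonal.1 hx).symm.trans
        (Finset.HasAntidiagonal.mem_antidiagonal.1 hx'))]
    simp
  have hsum : ∀ n : ℕ, 2 * ∑ i ∈ Finset.range (n + 1), (i + 1) = (n + 1) * (n + 2) := fun n => by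
    induction n with
    | zero => simp
    | succ n ih => rw [Finset.sum_range_succ, mul_add, ih]; ring
  rw [restrictTotalDegree, Module.finrank_eq_nat_card_basis (basisRestrictSupport L _), hcard, hsum]

theorem exists_poly_separating {x y : Fin 2 → L} (h : x ≠ y) :
    ∃ p : MvPolynomial (Fin 2) L, p.totalDegree ≤ 1 ∧ eval x p ≠ 0 ∧ eval y p = 0 := by
  obtain ⟨i, hi⟩ := Function.ne_iff.1 h
  refine ⟨X i - C (y i), (totalDegree_sub_C_le _ _).trans (by simp), ?_, by simp⟩
  simpa [sub_eq_zero] using hi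

theorem exists_poly_interpolating (S : Finset (Fin 2 → L)) (c : (Fin 2 → L) → L) :
    ∃ p : MvPolynomial (Fin 2) L, p.totalDegree ≤ S.card ∧ ∀ x ∈ S, eval x p = c x := by
  classical
  have hdelta : ∀ x ∈ S, ∃ p : MvPolynomial (Fin 2) L, p.totalDegree ≤ S.card ∧
      eval x p = 1 ∧ ∀ y ∈ S, y ≠ x → eval y p = 0 := by
    intro x hx
    choose! l hl1 hlx hly using fun (y : Fin 2 → L) (h : x ≠ y) => exists_poly_separating h
    set r := ∏ y ∈ S.erase x, l y with hr
    have hrx : eval x r ≠ 0 := by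
      rw [hr, map_prod, Finset.prod_ne_zero_iff]
      exact fun y hy => hlx y (Finset.ne_of_mem_erase hy).symm
    refine ⟨C (eval x r)⁻¹ * r, ?_, by simp [hrx], fun y hy hyx => ?_⟩
    · refine (totalDegree_mul _ _).trans ?_
      rw [totalDegree_C, zero_add, hr]
      refine (totalDegree_finsetProd _ _).trans ((Finset.sum_le_card_nsmul _ _ 1 fun y hy =>
        hl1 y (Finset.ne_of_mem_erase hy).symm).trans ?_)
      simpa using Finset.card_le_card (Finset.erase_subset x S)
    · have : eval y r = 0 := by
        rw [hr, map_prod, Finset.prod_eq_zero (Finset.mem_erase.2 ⟨hyx, hy⟩) (hly y hyx.symm)]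
      rw [map_mul, this, mul_zero]
  choose! p hp1 hp2 hp3 using hdelta
  refine ⟨∑ x ∈ S, C (c x) * p x, totalDegree_finsetSum_le fun x hx =>
    (totalDegree_mul _ _).trans (by simpa using hp1 x hx), fun x hx => ?_⟩
  rw [map_sum, Finset.sum_eq_single x]
  · simp [hp2 x hx]
  · intro y hy hyx
    simp [hp3 y hy x hx hyx.symm]
  · exact fun h => (h hx).elim

theorem finrank_add_card_le {S : Finset (Fin 2 → L)} {d : ℕ} (hd : S.card ≤ d)
    {W : Submodule L (MvPolynomial (Fin 2) L)} (hW : W ≤ restrictTotalDegree (Fin 2) L d)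
    (hS : ∀ p ∈ W, ∀ x ∈ S, eval x p = 0) :
    Module.finrank L W + S.card ≤ Module.finrank L (restrictTotalDegree (Fin 2) L d) := by
  let ev : MvPolynomial (Fin 2) L →ₗ[L] (S → L) := LinearMap.pi fun x => (aeval x.1).toLinearMap
  let evd := ev.domRestrict (restrictTotalDegree (Fin 2) L d)
  have hsurj : Function.Surjective evd := by
    classical
    intro c
    obtain ⟨p, hp, hpc⟩ := exists_poly_interpolating S fun x => if h : x ∈ S then c ⟨x, h⟩ else 0
    refine ⟨⟨p, (mem_restrictTotalDegree _ _ p).2 (hp.trans hd)⟩, funext fun x => ?_⟩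
    simpa [evd, ev, aeval_eq_eval] using hpc x x.2
  have hrn := evd.finrank_range_add_finrank_ker
  rw [LinearMap.range_eq_top.2 hsurj, finrank_top, Module.finrank_fintype_fun_eq_card,
    Fintype.card_coe] at hrn
  rw [← hrn, add_comm, ← (Submodule.comapSubtypeEquivOfLe hW).finrank_eq]
  refine Nat.add_le_add_left (Submodule.finrank_mono fun p hp => ?_) _
  rw [LinearMap.mem_ker]
  funext x
  simpa [evd, ev, aeval_eq_eval] using hS p hp x x.2

/-- A weak form of Bézout's theorem. -/
theorem card_common_zeros_le {φ g : MvPolynomial (Fin 2) L} (hφ : Irreducible φ) (hg : ¬ φ ∣ g)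
    {e : ℕ} (he : g.totalDegree ≤ e) {S : Finset (Fin 2 → L)}
    (hSφ : ∀ x ∈ S, eval x φ = 0) (hSg : ∀ x ∈ S, eval x g = 0) :
    S.card ≤ φ.totalDegree * e := by
  set m := φ.totalDegree with hm
  have hφ0 := hφ.ne_zero
  have hg0 : g ≠ 0 := fun h => hg (h ▸ dvd_zero φ)
  let V := restrictTotalDegree (Fin 2) L
  have hV : ∀ {d p}, p ∈ V d ↔ p.totalDegree ≤ d := fun {d p} => mem_restrictTotalDegree _ _ _
  let μ : MvPolynomial (Fin 2) L → MvPolynomial (Fin 2) L →ₗ[L] MvPolynomial (Fin 2) L :=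
    LinearMap.mulLeft L
  have hμ : ∀ {p}, p ≠ 0 → Function.Injective (μ p) := fun hp => mul_right_injective₀ hp
  set n := S.card with hn
  let A := (V (n + e)).map (μ φ)
  let B := (V (n + m)).map (μ g)
  have hA : Module.finrank L A = Module.finrank L (V (n + e)) :=
    (Submodule.equivMapOfInjective _ (hμ hφ0) _).finrank_eq.symm
  have hB : Module.finrank L B = Module.finrank L (V (n + m)) :=
    (Submodule.equivMapOfInjective _ (hμ hg0) _).finrank_eq.symm
  have hAB : A ⊓ B ≤ (V n).map (μ (φ * g)) := by
    rintro _ ⟨⟨u, -, rfl⟩, ⟨w, hw, h⟩⟩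
    simp only [μ, LinearMap.mulLeft_apply] at h
    obtain ⟨z, rfl⟩ := (hφ.prime.dvd_or_dvd (Dvd.intro u h.symm)).resolve_left hg
    refine ⟨z, ?_, by simp only [μ, LinearMap.mulLeft_apply]; rw [← h]; ring⟩
    rcases eq_or_ne z 0 with rfl | hz
    · exact (V n).zero_mem
    · have hw' := hV.1 hw
      rw [totalDegree_mul_of_isDomain hφ0 hz] at hw'
      exact hV.2 (by omega)
  have hAB' : Module.finrank L ↥(A ⊓ B) ≤ Module.finrank L (V n) :=
    (Submodule.finrank_mono hAB).trans (Submodule.finrank_map_le _ _)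
  have hle : A ⊔ B ≤ V (n + m + e) := by
    refine sup_le ?_ ?_
    · rintro _ ⟨u, hu, rfl⟩
      exact hV.2 ((totalDegree_mul _ _).trans (by have := hV.1 hu; omega))
    · rintro _ ⟨u, hu, rfl⟩
      exact hV.2 ((totalDegree_mul _ _).trans (by have := hV.1 hu; omega))
  have hvan : ∀ p ∈ A ⊔ B, ∀ x ∈ S, eval x p = 0 := by
    intro p hp x hx
    obtain ⟨_, ⟨u, -, rfl⟩, _, ⟨w, -, rfl⟩, rfl⟩ := Submodule.mem_sup.1 hp
    simp [μ, hSφ x hx, hSg x hx]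
  have key := finrank_add_card_le (d := n + m + e) (by omega) hle hvan
  have hsum := Submodule.finrank_sup_add_finrank_inf_eq A B
  have h1 := two_mul_finrank_restrictTotalDegree (L := L) (n + e)
  have h2 := two_mul_finrank_restrictTotalDegree (L := L) (n + m)
  have h3 := two_mul_finrank_restrictTotalDegree (L := L) (n + m + e)
  have h4 := two_mul_finrank_restrictTotalDegree (L := L) n
  rw [hA, hB] at hsum
  simp only [V] at *
  nlinarith

end Bezout

section PlaneCurves

variable {L : Type*} [Field L]

theorem exists_irreducible_dvd_many_zeros (S : Finset (Fin 2 → L)) (c : ℕ)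
    {g : MvPolynomial (Fin 2) L} (hg : g ≠ 0) (hS : ∀ x ∈ S, eval x g = 0)
    (hc : c * g.totalDegree < S.card) :
    ∃ φ, Irreducible φ ∧ φ ∣ g ∧ ∃ K ⊆ S, (∀ x ∈ K, eval x φ = 0) ∧
      c * φ.totalDegree < K.card := by
  classical
  induction g using WfDvdMonoid.induction_on_irreducible generalizing S with
  | zero => exact (hg rfl).elim
  | unit u hu =>
    rw [Finset.eq_empty_of_forall_notMem fun x hx =>
      (hu.map (eval x)).ne_zero (hS x hx)] at hc
    simp at hc
  | mul a i ha hi ih =>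
    by_cases h : c * i.totalDegree < (S.filter fun x => eval x i = 0).card
    · exact ⟨i, hi, dvd_mul_right i a, _, Finset.filter_subset _ _, by simp, h⟩
    · have hsplit := S.card_filter_add_card_filter_not fun x => eval x i = 0
      rw [totalDegree_mul_of_isDomain hi.ne_zero ha, mul_add] at hc
      obtain ⟨φ, h1, h2, K, hK, h3, h4⟩ := ih (S.filter fun x => ¬ eval x i = 0) ha
        (fun x hx => by
          rw [Finset.mem_filter] at hx
          simpa [hx.2] using hS x hx.1) (by omega)
      exact ⟨φ, h1, h2.mul_left i, K, hK.trans (Finset.filter_subset _ _), h3, h4⟩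

theorem totalDegree_pderiv_lt {p : MvPolynomial (Fin 2) L} (hp : 0 < p.totalDegree) (i : Fin 2) :
    (pderiv i p).totalDegree < p.totalDegree := by
  rw [totalDegree, Finset.sup_lt_iff (by simpa using hp)]
  intro m hm
  rw [mem_support_iff, coeff_pderiv] at hm
  have h := le_totalDegree (mem_support_iff.2 (left_ne_zero_of_mul hm))
  rw [Finsupp.sum_fintype _ _ (by simp)] at h ⊢
  simp only [Finsupp.add_apply, Finset.sum_add_distrib, Finsupp.single_apply] at h
  simpa using h

theorem exists_pderiv_ne_zero [IsAlgClosed L] {p : ℕ} [Fact p.Prime] [CharP L p]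
    {φ : MvPolynomial (Fin 2) L} (hφ : Irreducible φ) : ∃ i, pderiv i φ ≠ 0 := by
  by_contra! h
  have hdvd : ∀ m ∈ φ.support, ∀ i, p ∣ m i := by
    intro m hm i
    by_cases hmi : m i = 0
    · simp [hmi]
    have hle : Finsupp.single i 1 ≤ m := by
      rw [Finsupp.single_le_iff]; omega
    have hc := congrArg (coeff (m - Finsupp.single i 1)) (h i)
    rw [coeff_pderiv, tsub_add_cancel_of_le hle, coeff_zero] at hc
    have := (mul_eq_zero.1 hc).resolve_left (mem_support_iff.1 hm)
    rw [← CharP.cast_eq_zero_iff L p, ← this, Finsupp.tsub_apply, Finsupp.single_eq_same]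
    norm_cast
    rw [Nat.sub_add_cancel (by omega)]
  have hp := (Fact.out : p.Prime)
  choose b hb using fun x : L => IsAlgClosed.exists_pow_nat_eq x hp.pos
  have hpow : φ = (∑ m ∈ φ.support, C (b (coeff m φ)) * ∏ i, X i ^ (m i / p)) ^ p := by
    rw [sum_pow_char]
    conv_lhs => rw [φ.as_sum]
    refine Finset.sum_congr rfl fun m hm => ?_
    rw [mul_pow, ← map_pow, hb, ← Finset.prod_pow, monomial_eq, Finsupp.prod_fintype _ _ (by simp)]
    congr 1
    refine Finset.prod_congr rfl fun i _ => ?_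
    rw [← pow_mul, Nat.div_mul_cancel (hdvd m hm i)]
  exact not_irreducible_pow hp.ne_one (hpow ▸ hφ)

/-- A polynomial function that is not identically zero. -/
def PolyFunNe (h : (Fin 2 → L) → L) : Prop := (∃ d, PolyFun d h) ∧ ∃ v, h v ≠ 0

namespace PolyFunNe

variable [Infinite L]

theorem mul {h k : (Fin 2 → L) → L} (hh : PolyFunNe h) (hk : PolyFunNe k) :
    PolyFunNe fun v => h v * k v := by
  obtain ⟨⟨d, p, hp, H⟩, v, hv⟩ := hh
  obtain ⟨⟨e, r, hr, K⟩, w, hw⟩ := hk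
  refine ⟨⟨d + e, PolyFun.mul ⟨p, hp, H⟩ ⟨r, hr, K⟩⟩, ?_⟩
  by_contra! hz
  have : p * r = 0 := MvPolynomial.funext fun x => by simpa [H, K] using hz x
  rcases mul_eq_zero.1 this with rfl | rfl
  · exact hv (by simp [H])
  · exact hw (by simp [K])

theorem prod {ι : Type*} (s : Finset ι) {h : ι → (Fin 2 → L) → L}
    (H : ∀ i ∈ s, PolyFunNe (h i)) : PolyFunNe fun v => ∏ i ∈ s, h i v := by
  classical
  induction s using Finset.induction_on with
  | empty => exact ⟨⟨0, by simpa using PolyFun.const 1⟩, 0, by simp⟩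
  | insert a s ha ih =>
    simp only [Finset.prod_insert ha]
    exact (H a (by simp)).mul (ih fun i hi => H i (by simp [hi]))

theorem of_poly {p : MvPolynomial (Fin 2) L} (hp : p ≠ 0) : PolyFunNe fun v => eval v p := by
  refine ⟨⟨_, PolyFun.of_poly le_rfl⟩, ?_⟩
  by_contra! h
  exact hp (MvPolynomial.funext fun x => by simpa using h x)

end PolyFunNe

end PlaneCurves

/-- Polynomials `f y` of degree at most `t`, attached to the points `y` of `S`, which behave like
the products of the tangent lines at the points of a planar arc. -/
structure TangentSystem {L : Type*} [Field L] (S : Finset (Fin 2 → L)) (t : ℕ)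
    (f : (Fin 2 → L) → MvPolynomial (Fin 2) L) : Prop where
  totalDegree_le : ∀ y ∈ S, (f y).totalDegree ≤ t
  homogeneous : ∀ y ∈ S, ∀ (s : L) v, eval (y + s • v) (f y) = s ^ t * eval (y + v) (f y)
  skew : ∀ x ∈ S, ∀ y ∈ S, x ≠ y → eval x (f y) = (-1) ^ (t + 1) * eval y (f x)
  ne_zero : ∀ x ∈ S, ∀ y ∈ S, x ≠ y → eval x (f y) ≠ 0

/-- The two-variable interpolation of a system of polynomials `f`. -/
noncomputable def interpKernel {L : Type*} [Field L] (S : Finset (Fin 2 → L))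
    (g f : (Fin 2 → L) → MvPolynomial (Fin 2) L) (ξ η : Fin 2 → L) : L :=
  ∑ x ∈ S, eval η (g x) * eval ξ (f x)

section Kernel

variable {L : Type*} [Field L]

theorem exists_interpolation_basis (S : Finset (Fin 2 → L)) (t : ℕ) :
    ∃ g : (Fin 2 → L) → MvPolynomial (Fin 2) L, (∀ x, (g x).totalDegree ≤ t) ∧
      ∀ h : MvPolynomial (Fin 2) L, h.totalDegree ≤ t → ∀ y ∈ S,
        ∑ x ∈ S, eval y (g x) * eval x h = eval y h := by
  classical
  let V := restrictTotalDegree (Fin 2) L t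
  have hV : ∀ {p}, p ∈ V ↔ p.totalDegree ≤ t := fun {p} => mem_restrictTotalDegree _ _ _
  let E : V →ₗ[L] (S → L) :=
    (LinearMap.pi fun x : S => (aeval (R := L) x.1).toLinearMap).domRestrict V
  have hE : ∀ p x, E p x = eval x.1 p.1 := fun p x => by simp [E, aeval_eq_eval]
  obtain ⟨r, hr⟩ := E.rangeRestrict.exists_rightInverse_of_surjective E.range_rangeRestrict
  obtain ⟨s, hs⟩ := LinearMap.exists_extend r
  have hsE : ∀ p, E (s (E p)) = E p := fun p => by
    have h1 : s (E p) = r (E.rangeRestrict p) := LinearMap.congr_fun hs (E.rangeRestrict p)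
    rw [h1]
    exact congrArg Subtype.val (LinearMap.congr_fun hr (E.rangeRestrict p))
  refine ⟨fun x => if hx : x ∈ S then (s (Pi.single ⟨x, hx⟩ 1)).1 else 0, fun x => ?_, ?_⟩
  · dsimp only
    split_ifs with hx
    · exact hV.1 (s _).2
    · simp
  · intro h hh y hy
    have h1 := congrFun (hsE ⟨h, hV.2 hh⟩) ⟨y, hy⟩
    rw [LinearMap.pi_apply_eq_sum_univ s, map_sum] at h1
    simp only [map_smul, Finset.sum_apply, Pi.smul_apply, hE, smul_eq_mul] at h1
    rw [← h1, ← Finset.sum_coe_sort S]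
    refine Finset.sum_congr rfl fun x _ => ?_
    rw [mul_comm]
    dsimp only
    rw [dif_pos x.2]
    congr 4
    funext j
    rw [Pi.single_apply]
    exact if_congr eq_comm rfl rfl

variable {S : Finset (Fin 2 → L)} {t : ℕ} {f : (Fin 2 → L) → MvPolynomial (Fin 2) L}

theorem TangentSystem.subset (hf : TangentSystem S t f) {T : Finset (Fin 2 → L)} (hT : T ⊆ S) :
    TangentSystem T t f where
  totalDegree_le y hy := hf.totalDegree_le y (hT hy)
  homogeneous y hy := hf.homogeneous y (hT hy)
  skew x hx y hy := hf.skew x (hT hx) y (hT hy)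
  ne_zero x hx y hy := hf.ne_zero x (hT hx) y (hT hy)

theorem TangentSystem.eval_self (hf : TangentSystem S t f) (ht : t ≠ 0) {y : Fin 2 → L}
    (hy : y ∈ S) : eval y (f y) = 0 := by
  simpa [ht] using hf.homogeneous y hy 0 0

theorem TangentSystem.skew' (hf : TangentSystem S t f) (ht : t ≠ 0) {x y : Fin 2 → L}
    (hx : x ∈ S) (hy : y ∈ S) : eval x (f y) = (-1) ^ (t + 1) * eval y (f x) := by
  by_cases h : x = y
  · rw [h, hf.eval_self ht hy, mul_zero]
  · exact hf.skew x hx y hy h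

theorem TangentSystem.exists_kernel (hf : TangentSystem S t f) (ht : t ≠ 0)
    {Z : Set (Fin 2 → L)}
    (hZ : ∀ p : MvPolynomial (Fin 2) L, p.totalDegree ≤ t → (∀ x ∈ S, eval x p = 0) →
      ∀ z ∈ Z, eval z p = 0) :
    ∃ g : (Fin 2 → L) → MvPolynomial (Fin 2) L, (∀ x, (g x).totalDegree ≤ t) ∧
      (∀ y ∈ S, ∀ ξ ∈ Z, interpKernel S g f ξ y = eval ξ (f y)) ∧
      ∀ ξ ∈ Z, ∀ η ∈ Z,
        interpKernel S g f ξ η = (-1) ^ (t + 1) * interpKernel S g f η ξ := by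
  obtain ⟨g, hg, hgS⟩ := exists_interpolation_basis S t
  have hext : ∀ {h k : (Fin 2 → L) → L}, PolyFun t h → PolyFun t k → (∀ x ∈ S, h x = k x) →
      ∀ z ∈ Z, h z = k z := by
    intro h k hh hk hhk z hz
    obtain ⟨p, hp, hpe⟩ := hh.sub hk
    have := hZ p hp (fun x hx => (hpe x).symm.trans (sub_eq_zero.2 (hhk x hx))) z hz
    exact sub_eq_zero.1 ((hpe z).trans this)
  have hsq : ((-1 : L) ^ (t + 1)) * (-1) ^ (t + 1) = 1 := by
    rw [← mul_pow]; simp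
  have hleft : ∀ η, PolyFun t fun ξ => interpKernel S g f ξ η := fun η =>
    PolyFun.sum _ fun x hx => (PolyFun.of_poly (hf.totalDegree_le x hx)).const_mul _
  have hright : ∀ ξ, PolyFun t fun η => interpKernel S g f ξ η := fun ξ =>
    PolyFun.sum _ fun x _ => by
      simpa only [mul_comm] using (PolyFun.of_poly (hg x)).const_mul (eval ξ (f x))
  have hSS : ∀ x ∈ S, ∀ y ∈ S, interpKernel S g f x y = eval x (f y) := by
    intro x hx y hy
    rw [hf.skew' ht hx hy, ← hgS _ (hf.totalDegree_le x hx) y hy, Finset.mul_sum]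
    refine Finset.sum_congr rfl fun z hz => ?_
    rw [hf.skew' ht hx hz]
    ring
  have h1 : ∀ y ∈ S, ∀ ξ ∈ Z, interpKernel S g f ξ y = eval ξ (f y) := fun y hy =>
    hext (hleft y) (PolyFun.of_poly (hf.totalDegree_le y hy)) fun x hx => hSS x hx y hy
  have h2 : ∀ y ∈ S, ∀ ξ ∈ Z, interpKernel S g f y ξ = (-1) ^ (t + 1) * eval ξ (f y) :=
    fun y hy => hext (hright y) ((PolyFun.of_poly (hf.totalDegree_le y hy)).const_mul _)
      fun x hx => by rw [hSS y hy x hx, hf.skew' ht hy hx]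
  refine ⟨g, hg, h1, fun ξ hξ => ?_⟩
  refine hext (hright ξ) ((hleft ξ).const_mul _) fun y hy => ?_
  rw [h1 y hy ξ hξ, h2 y hy ξ hξ, ← mul_assoc, hsq, one_mul]

theorem TangentSystem.exists_poly_vanishing (hf : TangentSystem S t f) (ht : t ≠ 0)
    (h2 : (2 : L) ≠ 0) {x y : Fin 2 → L} (hx : x ∈ S) (hy : y ∈ S) (hxy : x ≠ y) :
    ∃ p : MvPolynomial (Fin 2) L, p ≠ 0 ∧ p.totalDegree ≤ 2 * t ∧ ∀ x ∈ S, eval x p = 0 := by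
  by_contra! hno
  have hvan : ∀ {h : (Fin 2 → L) → L}, PolyFun (2 * t) h → (∀ x ∈ S, h x = 0) →
      ∀ z, h z = 0 := by
    rintro h ⟨p, hp, hpe⟩ hh z
    by_contra hz
    obtain ⟨w, hw, hwp⟩ := hno p (fun h0 => hz (by rw [hpe, h0, map_zero])) hp
    exact hwp ((hpe w).symm.trans (hh w hw))
  obtain ⟨g, hg, hgS, hskew⟩ := hf.exists_kernel ht (Z := Set.univ)
    fun p hp hpS z _ => hvan (PolyFun.of_poly (hp.trans (by omega))) hpS z
  have hhom : ∀ u w (s : L), interpKernel S g f (w + s • (u - w)) w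
      = s ^ t * interpKernel S g f u w := by
    intro u w s
    rw [← sub_eq_zero]
    refine hvan (h := fun w => interpKernel S g f (w + s • (u - w)) w
      - s ^ t * interpKernel S g f u w) (PolyFun.sub ?_ (PolyFun.const_mul _ ?_)) ?_ w
    · refine PolyFun.sum _ fun x hx => ?_
      rw [two_mul]
      refine (PolyFun.of_poly (hg x)).mul (PolyFun.comp (hf.totalDegree_le x hx) fun i => ?_)
      simp only [Pi.add_apply, Pi.smul_apply, Pi.sub_apply, smul_eq_mul]
      exact (PolyFun.coord i).add (((PolyFun.const _).sub (PolyFun.coord i)).const_mul s)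
    · refine (PolyFun.sum _ fun x _ => ?_).mono (by omega : t ≤ 2 * t)
      simpa only [mul_comm] using (PolyFun.of_poly (hg x)).const_mul (eval u (f x))
    · intro y hy
      rw [hgS y hy _ trivial, hgS y hy _ trivial, hf.homogeneous y hy]
      simp
  set z : Fin 2 → L := (2 : L)⁻¹ • (x + y) with hz
  have e1 : y + (2 : L)⁻¹ • (x - y) = z := by
    funext i; simp only [hz, Pi.add_apply, Pi.smul_apply, Pi.sub_apply, smul_eq_mul]
    field_simp; ring
  have e2 : x + (2 : L)⁻¹ • (y - x) = z := by
    funext i; simp only [hz, Pi.add_apply, Pi.smul_apply, Pi.sub_apply, smul_eq_mul]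
    field_simp; ring
  have e3 : z + (-1 : L) • (y - z) = x := by
    funext i; simp only [hz, Pi.add_apply, Pi.smul_apply, Pi.sub_apply, smul_eq_mul]
    field_simp; ring
  have k1 := hhom x y 2⁻¹
  have k2 := hhom y x 2⁻¹
  have k3 := hhom y z (-1)
  rw [e1, hgS y hy x trivial] at k1
  rw [e2, hgS x hx y trivial, hf.skew y hy x hx hxy.symm] at k2
  rw [e3, hskew x trivial z trivial, hskew y trivial z trivial, k1, k2] at k3
  have hne := hf.ne_zero x hx y hy hxy
  have hpow : ((2 : L)⁻¹) ^ t ≠ 0 := pow_ne_zero _ (inv_ne_zero h2)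
  have hs : ((-1 : L) ^ t) * (-1) ^ t = 1 := by rw [← mul_pow]; simp
  have : 2 * (((2 : L)⁻¹) ^ t * eval x (f y)) = 0 := by
    rw [pow_succ] at k3
    linear_combination k3 - 2 * (((2 : L)⁻¹) ^ t * eval x (f y)) * hs
  exact mul_ne_zero h2 (mul_ne_zero hpow hne) this

end Kernel

section LineIntersections

variable {L : Type*} [Field L] {v : Fin 2 → L} {φ : MvPolynomial (Fin 2) L} {m : ℕ}

/-- On the curve `φ = 0`, powers of the parameter `s` of the line `Y + s v` reduce to powers of
exponent less than `m`. -/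
theorem exists_power_reduction (hm : φ.totalDegree = m)
    (hv : eval v (homogeneousComponent m φ) ≠ 0) (n : ℕ) :
    ∃ r : Fin m → (Fin 2 → L) → L, (∀ j, PolyFun n (r j)) ∧
      ∀ Y (s : L), eval (Y + s • v) φ = 0 → s ^ n = ∑ j, r j Y * s ^ (j : ℕ) := by
  induction n using Nat.strong_induction_on with
  | _ n ih =>
    by_cases hn : n < m
    · refine ⟨fun j _ => if j = ⟨n, hn⟩ then 1 else 0, fun j => PolyFun.const _, fun Y s _ => ?_⟩
      simp
    · choose! r hr hrs using ih
      set c := eval v (homogeneousComponent m φ)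
      have hfam := polyFamily_lineRestrict v φ hm.le
      refine ⟨fun j Y => -c⁻¹ * ∑ i ∈ Finset.range m,
        (lineRestrict v φ Y).coeff i * r (n - m + i) j Y, fun j => ?_, fun Y s hs => ?_⟩
      · refine PolyFun.const_mul _ (PolyFun.sum _ fun i hi => ?_)
        rw [Finset.mem_range] at hi
        exact ((hfam.2 i hi.le).mul (hr (n - m + i) (by omega) j)).mono (by omega)
      · have hsum := eval_lineRestrict v φ Y s
        rw [hs, Polynomial.eval_eq_sum_range' (Nat.lt_succ_of_le (hfam.1 Y)),
          Finset.sum_range_succ, coeff_lineRestrict_top v φ hm.le] at hsum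
        have hexp : ∑ j, (∑ i ∈ Finset.range m, (lineRestrict v φ Y).coeff i *
            r (n - m + i) j Y) * s ^ (j : ℕ) =
            s ^ (n - m) * ∑ i ∈ Finset.range m, (lineRestrict v φ Y).coeff i * s ^ i := by
          simp only [Finset.sum_mul, Finset.mul_sum]
          rw [Finset.sum_comm]
          refine Finset.sum_congr rfl fun i hi => ?_
          rw [Finset.mem_range] at hi
          rw [mul_left_comm, ← pow_add, hrs (n - m + i) (by omega) Y s hs, Finset.mul_sum]
          exact Finset.sum_congr rfl fun j _ => by ring
        simp only [mul_assoc]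
        rw [← Finset.mul_sum, hexp, eq_neg_of_add_eq_zero_left hsum]
        rw [← Nat.sub_add_cancel (not_lt.1 hn), pow_add, Nat.add_sub_cancel]
        change _ = -c⁻¹ * (s ^ (n - m) * -(c * s ^ m))
        field_simp

theorem exists_family_reduction (hm : φ.totalDegree = m)
    (hv : eval v (homogeneousComponent m φ) ≠ 0) {d : ℕ} {P : (Fin 2 → L) → Polynomial L}
    (hP : PolyFamily d P) :
    ∃ G : Fin m → (Fin 2 → L) → L, (∀ j, PolyFun d (G j)) ∧
      ∀ Y (s : L), eval (Y + s • v) φ = 0 → (P Y).eval s = ∑ j, G j Y * s ^ (j : ℕ) := by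
  choose r hr hrs using exists_power_reduction hm hv
  refine ⟨fun j Y => ∑ i ∈ Finset.range (d + 1), (P Y).coeff i * r i j Y, fun j => ?_,
    fun Y s hs => ?_⟩
  · refine PolyFun.sum _ fun i hi => ?_
    rw [Finset.mem_range] at hi
    exact ((hP.2 i (by omega)).mul (hr i j)).mono (by omega)
  · rw [Polynomial.eval_eq_sum_range' (Nat.lt_succ_of_le (hP.1 Y))]
    simp only [Finset.sum_mul]
    rw [Finset.sum_comm]
    refine Finset.sum_congr rfl fun i _ => ?_
    rw [hrs i Y s hs, Finset.mul_sum]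
    exact Finset.sum_congr rfl fun j _ => by ring

theorem eval_mul_pow_eq_on_curve (hm : φ.totalDegree = m)
    (hv : eval v (homogeneousComponent m φ) ≠ 0) {d t : ℕ} {P : (Fin 2 → L) → Polynomial L}
    (hP : PolyFamily d P) {K : Finset (Fin 2 → L)}
    (hK : ∀ p : MvPolynomial (Fin 2) L, p.totalDegree ≤ d + t → (∀ x ∈ K, eval x p = 0) →
      ∀ z, eval z φ = 0 → eval z p = 0)
    (hroots : ∀ y ∈ K, ∃ R : Finset L, R.card = m ∧ ∀ s ∈ R, eval (y + s • v) φ = 0)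
    (hprop : ∀ y ∈ K, ∃ a : L, ∀ s, eval (y + s • v) φ = 0 → (P y).eval s = a * s ^ t)
    {η : Fin 2 → L} (hη : eval η φ = 0) {s₁ s₂ : L} (h₁ : eval (η + s₁ • v) φ = 0)
    (h₂ : eval (η + s₂ • v) φ = 0) :
    (P η).eval s₁ * s₂ ^ t = (P η).eval s₂ * s₁ ^ t := by
  obtain ⟨G, hG, hGs⟩ := exists_family_reduction hm hv hP
  obtain ⟨r, hr, hrs⟩ := exists_power_reduction hm hv t
  have hcross : ∀ i j, G i η * r j η = G j η * r i η := by
    intro i j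
    obtain ⟨p, hp, hpe⟩ := ((hG i).mul (hr j)).sub ((hG j).mul (hr i))
    refine sub_eq_zero.1 ((hpe η).trans (hK p hp (fun y hy => (hpe y).symm.trans ?_) η hη))
    obtain ⟨R, hRc, hR⟩ := hroots y hy
    obtain ⟨a, ha⟩ := hprop y hy
    have hpoly : ∑ j : Fin m, Polynomial.C (G j y - a * r j y) * Polynomial.X ^ (j : ℕ) = 0 := by
      refine Polynomial.eq_zero_of_degree_lt_of_eval_finset_eq_zero R
        ((Polynomial.degree_sum_fin_lt _).trans_eq (by rw [hRc])) fun s hs => ?_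
      have h := ha s (hR s hs)
      rw [hGs y s (hR s hs), hrs y s (hR s hs), Finset.mul_sum, ← sub_eq_zero,
        ← Finset.sum_sub_distrib] at h
      rw [Polynomial.eval_finsetSum, ← h]
      refine Finset.sum_congr rfl fun j _ => ?_
      simp only [Polynomial.eval_mul, Polynomial.eval_C, Polynomial.eval_pow, Polynomial.eval_X]
      ring
    have hGr : ∀ j, G j y = a * r j y := fun j => by
      have h := congrArg (fun p => Polynomial.coeff p (j : ℕ)) hpoly
      simp only [Polynomial.finsetSum_coeff, Polynomial.coeff_C_mul, Polynomial.coeff_X_pow,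
        Polynomial.coeff_zero, mul_ite, mul_one, mul_zero, Fin.val_inj, Finset.sum_ite_eq,
        Finset.mem_univ, if_true] at h
      exact sub_eq_zero.1 h
    simp only [hGr]
    ring
  rw [hGs η s₁ h₁, hGs η s₂ h₂, hrs η s₁ h₁, hrs η s₂ h₂, Finset.sum_mul_sum,
    Finset.sum_mul_sum, Finset.sum_comm]
  refine Finset.sum_congr rfl fun i _ => Finset.sum_congr rfl fun j _ => ?_
  linear_combination s₁ ^ (j : ℕ) * s₂ ^ (i : ℕ) * hcross j i

theorem exists_card_eq_roots [IsAlgClosed L] (hm : φ.totalDegree = m)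
    (hv : eval v (homogeneousComponent m φ) ≠ 0) {y : Fin 2 → L}
    (hy : ∀ s : L, eval (y + s • v) φ = 0 →
      eval (y + s • v) (∑ i, C (v i) * pderiv i φ) ≠ 0) :
    ∃ R : Finset L, R.card = m ∧ ∀ s, s ∈ R ↔ eval (y + s • v) φ = 0 := by
  classical
  set P := lineRestrict v φ y with hP
  have hcoeff : P.coeff m ≠ 0 := by rwa [hP, coeff_lineRestrict_top v φ hm.le]
  have hP0 : P ≠ 0 := fun h => hcoeff (by rw [h, Polynomial.coeff_zero])
  have hdeg : P.natDegree = m := le_antisymm ((polyFamily_lineRestrict v φ hm.le).1 y)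
    (Polynomial.le_natDegree_of_ne_zero hcoeff)
  have hnodup : P.roots.Nodup := by
    rw [Multiset.nodup_iff_count_le_one]
    intro s
    rw [Polynomial.count_roots]
    by_contra! h
    rw [Polynomial.one_lt_rootMultiplicity_iff_isRoot hP0] at h
    have h1 := h.1
    have h2 := h.2
    rw [hP, Polynomial.IsRoot, eval_lineRestrict] at h1
    rw [hP, Polynomial.IsRoot, derivative_lineRestrict, eval_lineRestrict] at h2
    exact hy s h1 h2
  refine ⟨P.roots.toFinset, ?_, fun s => ?_⟩
  · rw [Multiset.toFinset_card_of_nodup hnodup, ← (IsAlgClosed.splits P).natDegree_eq_card_roots,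
      hdeg]
  · rw [Multiset.mem_toFinset, Polynomial.mem_roots hP0, Polynomial.IsRoot, hP, eval_lineRestrict]

end LineIntersections

section Core

variable {L : Type*} [Field L] {S : Finset (Fin 2 → L)} {t : ℕ}
  {f : (Fin 2 → L) → MvPolynomial (Fin 2) L}

theorem homogeneousComponent_totalDegree_ne_zero {φ : MvPolynomial (Fin 2) L} (hφ : φ ≠ 0) :
    homogeneousComponent φ.totalDegree φ ≠ 0 := by
  obtain ⟨e, he, hdeg⟩ := Finset.exists_mem_eq_sup φ.support (support_nonempty.2 hφ)
    fun s => s.sum fun _ n => n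
  intro h
  have hc := congrArg (coeff e) h
  rw [coeff_homogeneousComponent, coeff_zero, if_pos] at hc
  · exact mem_support_iff.1 he hc
  · rw [Finsupp.degree_eq_sum, totalDegree, hdeg, Finsupp.sum_fintype _ _ (by simp)]

/-- A direction in general position with respect to the curve `φ = 0` and to a tangent system. -/
theorem TangentSystem.exists_direction [IsAlgClosed L] {p : ℕ} [Fact p.Prime] [CharP L p]
    (hf : TangentSystem S t f) {x y : Fin 2 → L} (hx : x ∈ S) (hy : y ∈ S) (hxy : x ≠ y)
    {φ : MvPolynomial (Fin 2) L} (hφ : Irreducible φ) :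
    ∃ v : Fin 2 → L, eval v (homogeneousComponent φ.totalDegree φ) ≠ 0 ∧
      ∑ i, C (v i) * pderiv i φ ≠ 0 ∧ (∀ z ∈ S, eval (z + v) (f z) ≠ 0) ∧
      ∀ z ∈ S, ∀ w ∈ S, ∀ a b : L, z + a • v = w + b • v → z = w := by
  classical
  obtain ⟨i, hi⟩ := exists_pderiv_ne_zero (p := p) hφ
  obtain ⟨e, he⟩ := ne_zero_iff.1 hi
  have H1 := PolyFunNe.of_poly (homogeneousComponent_totalDegree_ne_zero hφ.ne_zero)
  have H2 : PolyFunNe fun v : Fin 2 → L => ∑ j, v j * coeff e (pderiv j φ) := by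
    refine ⟨⟨1, PolyFun.sum _ fun j _ => ?_⟩, Pi.single i 1, ?_⟩
    · simpa only [mul_comm] using (PolyFun.coord j).const_mul (coeff e (pderiv j φ))
    · simpa [Pi.single_apply] using he
  have H3 : PolyFunNe fun v => ∏ z ∈ S, eval (z + v) (f z) := by
    refine PolyFunNe.prod _ fun z hz => ⟨⟨t, PolyFun.comp (hf.totalDegree_le z hz) fun j =>
      (PolyFun.const _).add (PolyFun.coord j)⟩, ?_⟩
    obtain ⟨w, hw, hwz⟩ : ∃ w ∈ S, w ≠ z := by
      by_cases h : x = z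
      · exact ⟨y, hy, fun h' => hxy (h.trans h'.symm)⟩
      · exact ⟨x, hx, h⟩
    exact ⟨w - z, by simpa using hf.ne_zero w hw z hz hwz⟩
  have H4 : PolyFunNe fun v : Fin 2 → L => ∏ z ∈ S, ∏ w ∈ S.erase z,
      ((z 0 - w 0) * v 1 - (z 1 - w 1) * v 0) := by
    refine PolyFunNe.prod _ fun z hz => PolyFunNe.prod _ fun w hw => ⟨⟨1, ?_⟩, ?_⟩
    · exact ((PolyFun.coord 1).const_mul _).sub ((PolyFun.coord 0).const_mul _)
    · by_cases h0 : z 0 = w 0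
      · have h1 : z 1 ≠ w 1 := fun h1 => (Finset.ne_of_mem_erase hw).symm
          (funext fun j => by fin_cases j <;> assumption)
        exact ⟨![1, 0], by simpa [h0, sub_eq_zero] using Ne.symm h1⟩
      · exact ⟨![0, 1], by simpa [sub_eq_zero] using h0⟩
  obtain ⟨-, v, hv⟩ := (H1.mul H2).mul (H3.mul H4)
  simp only [mul_ne_zero_iff, Finset.prod_ne_zero_iff] at hv
  refine ⟨v, hv.1.1, fun h => hv.1.2 ?_, hv.2.1, fun z hz w hw a b hab => ?_⟩
  · simpa [coeff_sum] using congrArg (coeff e) h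
  · by_contra hne
    refine hv.2.2 z hz w (Finset.mem_erase.2 ⟨fun h => hne h.symm, hw⟩) ?_
    have h0 := congrFun hab 0
    have h1 := congrFun hab 1
    simp only [Pi.add_apply, Pi.smul_apply, smul_eq_mul] at h0 h1
    linear_combination v 1 * h0 - v 0 * h1

theorem TangentSystem.false_of_curve [IsAlgClosed L] {p : ℕ} [Fact p.Prime] [CharP L p]
    (hf : TangentSystem S t f) (ht : t ≠ 0) (h2 : (2 : L) ≠ 0)
    {φ : MvPolynomial (Fin 2) L} (hφ : Irreducible φ) (hSφ : ∀ x ∈ S, eval x φ = 0)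
    (hm3 : 3 ≤ φ.totalDegree) (hmt : φ.totalDegree ≤ 2 * t)
    (hcard : 5 * t * φ.totalDegree < S.card) : False := by
  classical
  obtain ⟨x, hx, y, hy, hxy⟩ := Finset.one_lt_card.1
    (lt_of_le_of_lt (Nat.one_le_iff_ne_zero.2 (by positivity)) hcard)
  obtain ⟨v, hv, hD, hfv, hinj⟩ := hf.exists_direction (p := p) hx hy hxy hφ
  generalize hm : φ.totalDegree = m at *
  set D := ∑ i, C (v i) * pderiv i φ with hDdef
  have hDdeg : D.totalDegree ≤ m - 1 := totalDegree_finsetSum_le fun i _ => by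
    have := totalDegree_pderiv_lt (p := φ) (by omega) i
    refine (totalDegree_mul _ _).trans ?_
    rw [totalDegree_C]
    omega
  have hφD : ¬ φ ∣ D := fun h => by
    have := totalDegree_le_of_dvd_of_isDomain h hD
    omega
  set K := S.filter fun y => ∀ s : L, eval (y + s • v) φ = 0 → eval (y + s • v) D ≠ 0 with hKdef
  have hKS : K ⊆ S := Finset.filter_subset _ _
  have hbad : (S \ K).card ≤ m * (m - 1) := by
    have hex : ∀ y ∈ S \ K, ∃ s : L, eval (y + s • v) φ = 0 ∧ eval (y + s • v) D = 0 := by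
      intro y hy
      rw [Finset.mem_sdiff, hKdef, Finset.mem_filter] at hy
      simpa [hy.1] using hy.2
    choose! s hs1 hs2 using hex
    rw [← Finset.card_image_of_injOn (f := fun y => y + s y • v) fun y hy z hz h =>
      hinj y (Finset.mem_sdiff.1 hy).1 z (Finset.mem_sdiff.1 hz).1 _ _ h, ← hm]
    refine card_common_zeros_le hφ hφD (hm ▸ hDdeg) ?_ ?_
    · simpa only [Finset.forall_mem_image] using hs1
    · simpa only [Finset.forall_mem_image] using hs2
  have hKcard : m * (3 * t) < K.card := by
    have hsplit := Finset.card_sdiff_add_card_eq_card hKS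
    have : m * (m - 1) ≤ m * (2 * t) := Nat.mul_le_mul_left m (by omega)
    have e1 : 5 * t * m = m * (3 * t) + m * (2 * t) := by ring
    omega
  have hvan : ∀ p : MvPolynomial (Fin 2) L, p.totalDegree ≤ 2 * t + t →
      (∀ x ∈ K, eval x p = 0) → ∀ z, eval z φ = 0 → eval z p = 0 := by
    intro p hp hpK z hz
    have hdvd : φ ∣ p := by
      by_contra h
      have := card_common_zeros_le hφ h (hp.trans_eq (by ring : _ = 3 * t))
        (fun x hx => hSφ x (hKS hx)) hpK
      rw [hm] at this
      omega
    obtain ⟨r, rfl⟩ := hdvd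
    rw [map_mul, hz, zero_mul]
  obtain ⟨g, hg, hgK, hskew⟩ := (hf.subset hKS).exists_kernel ht (Z := {z | eval z φ = 0})
    fun p hp hpK z hz => hvan p (hp.trans (by omega)) hpK z hz
  let P : (Fin 2 → L) → Polynomial L := fun Y =>
    ∑ x ∈ K, Polynomial.C (eval Y (g x)) * lineRestrict v (f x) Y
  have hP : PolyFamily (2 * t) P := PolyFamily.sum _ fun x hx => by
    rw [two_mul]
    exact (PolyFamily.C_apply (PolyFun.of_poly (hg x))).mul
      (polyFamily_lineRestrict v _ (hf.totalDegree_le x (hKS hx)))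
  have hPeval : ∀ Y (s : L), (P Y).eval s = interpKernel K g f (Y + s • v) Y := fun Y s => by
    simp [P, interpKernel, Polynomial.eval_finsetSum, eval_lineRestrict]
  have hprop : ∀ y ∈ K, ∀ s : L, eval (y + s • v) φ = 0 →
      (P y).eval s = eval (y + v) (f y) * s ^ t := fun y hy s hs => by
    rw [hPeval, hgK y hy _ hs, hf.homogeneous y (hKS hy), mul_comm]
  have hroots : ∀ y ∈ K, ∃ R : Finset L, R.card = m ∧ ∀ s, s ∈ R ↔ eval (y + s • v) φ = 0 :=
    fun y hy => exists_card_eq_roots hm hv (Finset.mem_filter.1 hy).2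
  have hstar : ∀ {η : Fin 2 → L}, eval η φ = 0 → ∀ {s₁ s₂ : L}, eval (η + s₁ • v) φ = 0 →
      eval (η + s₂ • v) φ = 0 → interpKernel K g f (η + s₁ • v) η * s₂ ^ t
        = interpKernel K g f (η + s₂ • v) η * s₁ ^ t := by
    intro η hη s₁ s₂ h₁ h₂
    rw [← hPeval, ← hPeval]
    exact eval_mul_pow_eq_on_curve hm hv hP hvan
      (fun y hy => (hroots y hy).imp fun R hR => ⟨hR.1, fun s hs => (hR.2 s).1 hs⟩)
      (fun y hy => ⟨_, hprop y hy⟩) hη h₁ h₂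
  obtain ⟨y₀, hy₀⟩ := Finset.card_pos.1 (Nat.zero_lt_of_lt hKcard)
  obtain ⟨R, hRc, hR⟩ := hroots y₀ hy₀
  have hy₀φ : eval y₀ φ = 0 := hSφ y₀ (hKS hy₀)
  have h0R : (0 : L) ∈ R := (hR 0).2 (by simpa using hy₀φ)
  obtain ⟨s₁, hs₁, s₂, hs₂, hs⟩ := Finset.one_lt_card.1
    (by rw [Finset.card_erase_of_mem h0R]; omega : 1 < (R.erase 0).card)
  rw [Finset.mem_erase, hR] at hs₁ hs₂
  set η₁ := y₀ + s₁ • v with hη₁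
  set η₂ := y₀ + s₂ • v with hη₂
  set c := eval (y₀ + v) (f y₀) with hc
  have hc0 : c ≠ 0 := hfv y₀ (hKS hy₀)
  have a1 : interpKernel K g f y₀ η₁ = (-1) ^ (t + 1) * (c * s₁ ^ t) := by
    rw [hskew y₀ hy₀φ η₁ hs₁.2, ← hprop y₀ hy₀ s₁ hs₁.2, hPeval]
  have a2 : interpKernel K g f y₀ η₂ = (-1) ^ (t + 1) * (c * s₂ ^ t) := by
    rw [hskew y₀ hy₀φ η₂ hs₂.2, ← hprop y₀ hy₀ s₂ hs₂.2, hPeval]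
  have p1 : η₁ + (-s₁) • v = y₀ := by rw [hη₁]; module
  have p2 : η₁ + (s₂ - s₁) • v = η₂ := by rw [hη₁, hη₂]; module
  have p3 : η₂ + (-s₂) • v = y₀ := by rw [hη₂]; module
  have p4 : η₂ + (s₁ - s₂) • v = η₁ := by rw [hη₁, hη₂]; module
  have b1 := hstar hs₁.2 (s₁ := -s₁) (s₂ := s₂ - s₁) (p1 ▸ hy₀φ) (p2 ▸ hs₂.2)
  have b2 := hstar hs₂.2 (s₁ := -s₂) (s₂ := s₁ - s₂) (p3 ▸ hy₀φ) (p4 ▸ hs₁.2)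
  rw [p1, p2, a1, neg_pow] at b1
  rw [p3, p4, a2, neg_pow s₂, hskew η₁ hs₁.2 η₂ hs₂.2, ← neg_sub s₂ s₁, neg_pow (s₂ - s₁)] at b2
  have hsgn : ((-1 : L) ^ t) * (-1) ^ t = 1 := by rw [← mul_pow]; simp
  have hs₁t : s₁ ^ t ≠ 0 := pow_ne_zero _ hs₁.1
  have hs₂t : s₂ ^ t ≠ 0 := pow_ne_zero _ hs₂.1
  have hst : (s₂ - s₁) ^ t ≠ 0 := pow_ne_zero _ (sub_ne_zero.2 hs.symm)
  rw [pow_succ] at b1 b2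
  have c1 : interpKernel K g f η₂ η₁ = -(c * (s₂ - s₁) ^ t) := by
    refine mul_right_cancel₀ hs₁t ?_
    linear_combination (-(-1) ^ t) * b1 - (interpKernel K g f η₂ η₁ * s₁ ^ t
      + c * (s₂ - s₁) ^ t * s₁ ^ t) * hsgn
  have c2 : interpKernel K g f η₂ η₁ = c * (s₂ - s₁) ^ t := by
    refine mul_right_cancel₀ hs₂t ?_
    linear_combination b2 - (interpKernel K g f η₂ η₁ * s₂ ^ t
      - c * (s₂ - s₁) ^ t * s₂ ^ t) * hsgn
  have : 2 * (c * (s₂ - s₁) ^ t) = 0 := by linear_combination c1 - c2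
  exact mul_ne_zero h2 (mul_ne_zero hc0 hst) this

/-- A tangent system on a large point set none of whose subsets of size six lies on a conic cannot
exist. -/
theorem TangentSystem.false_of_conics [IsAlgClosed L] {p : ℕ} [Fact p.Prime] [CharP L p]
    (hf : TangentSystem S t f) (h2 : (2 : L) ≠ 0) (h3 : 3 ≤ S.card) (hcard : 10 * t ^ 2 < S.card)
    (hconic : ∀ φ : MvPolynomial (Fin 2) L, φ ≠ 0 → φ.totalDegree ≤ 2 →
      ∀ T ⊆ S, (∀ x ∈ T, eval x φ = 0) → T.card ≤ 5) : False := by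
  obtain ⟨x, hx, y, hy, z, hz, hxy, hxz, hyz⟩ := Finset.two_lt_card.1 h3
  rcases eq_or_ne t 0 with rfl | ht
  · have hconst : ∀ y ∈ S, ∀ x, eval x (f y) = eval y (f y) := fun y hy x => by
      rw [totalDegree_eq_zero_iff_eq_C.1 (Nat.le_zero.1 (hf.totalDegree_le y hy))]
      simp
    have e1 := hf.skew x hx y hy hxy
    have e2 := hf.skew x hx z hz hxz
    have e3 := hf.skew y hy z hz hyz
    have hne := hf.ne_zero x hx y hy hxy
    rw [hconst x hx, hconst y hy] at e1
    rw [hconst x hx, hconst z hz] at e2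
    rw [hconst y hy, hconst z hz] at e3
    rw [hconst y hy] at hne
    exact mul_ne_zero h2 hne (by linear_combination e1 - e2 + e3)
  · obtain ⟨g, hg0, hgdeg, hgS⟩ := hf.exists_poly_vanishing ht h2 hx hy hxy
    have hlt : 5 * t * g.totalDegree < S.card := by nlinarith
    obtain ⟨φ, hφ, hdvd, K, hKS, hKφ, hK⟩ := exists_irreducible_dvd_many_zeros S (5 * t) hg0 hgS hlt
    have hm3 : 3 ≤ φ.totalDegree := by
      by_contra! h
      have h5 := hconic φ hφ.ne_zero (by omega) K hKS hKφ
      have hpos : φ.totalDegree ≠ 0 := fun h0 => by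
        rw [totalDegree_eq_zero_iff_eq_C] at h0
        obtain ⟨w, hw⟩ := Finset.card_pos.1 (Nat.zero_lt_of_lt hK)
        have := hKφ w hw
        rw [h0, eval_C] at this
        exact hφ.ne_zero (by rw [h0, this, map_zero])
      have : 1 ≤ t * φ.totalDegree := Nat.one_le_iff_ne_zero.2 (mul_ne_zero ht hpos)
      rw [mul_assoc] at hK
      omega
    exact (hf.subset hKS).false_of_curve (p := p) ht h2 hφ hKφ hm3
      ((totalDegree_le_of_dvd_of_isDomain hdvd hg0).trans hgdeg) hK

end Core

/-- The determinant of three vectors in three-dimensional space. -/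
def det₃ {R : Type*} [CommRing R] (a b c : Fin 3 → R) : R :=
  a 0 * (b 1 * c 2 - b 2 * c 1) - a 1 * (b 0 * c 2 - b 2 * c 0) + a 2 * (b 0 * c 1 - b 1 * c 0)

section Segre

variable {F L : Type*} [Field F] [Field L] [Algebra F L]

theorem map_det₃ {R R' : Type*} [CommRing R] [CommRing R'] (g : R →+* R') (a b c : Fin 3 → R) :
    g (det₃ a b c) = det₃ (g ∘ a) (g ∘ b) (g ∘ c) := by
  simp [det₃]

theorem natDegree_det₃_le {a b c : Fin 3 → Polynomial L} {i j k : ℕ}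
    (ha : ∀ l, (a l).natDegree ≤ i) (hb : ∀ l, (b l).natDegree ≤ j)
    (hc : ∀ l, (c l).natDegree ≤ k) : (det₃ a b c).natDegree ≤ i + (j + k) := by
  have h : ∀ l m n, (a l * (b m * c n - b n * c m)).natDegree ≤ i + (j + k) := fun l m n =>
    Polynomial.natDegree_mul_le_of_le (ha l) (Polynomial.natDegree_sub_le_of_le
      (Polynomial.natDegree_mul_le_of_le (hb m) (hc n))
      (Polynomial.natDegree_mul_le_of_le (hb n) (hc m)) |>.trans_eq (max_self _))
  exact Polynomial.natDegree_add_le_of_degree_le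
    ((Polynomial.natDegree_sub_le_of_le (h 0 1 2) (h 1 0 2)).trans_eq (max_self _)) (h 2 0 1)

/-- The plane form `∑ pᵢ (X₁ - y₁)ⁱ (X₀ - y₀)ᵗ⁻ⁱ` attached to `p` and centred at `y`. -/
noncomputable def centredForm (t : ℕ) (p : Polynomial L) (y : Fin 2 → L) :
    MvPolynomial (Fin 2) L :=
  ∑ i ∈ Finset.range (t + 1), C (p.coeff i) * ((X 1 - C (y 1)) ^ i * (X 0 - C (y 0)) ^ (t - i))

theorem totalDegree_centredForm_le (t : ℕ) (p : Polynomial L) (y : Fin 2 → L) :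
    (centredForm t p y).totalDegree ≤ t := by
  have hlin : ∀ (j : Fin 2) n, ((X j - C (y j) : MvPolynomial (Fin 2) L) ^ n).totalDegree ≤ n :=
    fun j n => (totalDegree_pow _ _).trans ((Nat.mul_le_mul_left n
      ((totalDegree_sub_C_le _ _).trans (totalDegree_X j).le)).trans_eq (mul_one n))
  refine totalDegree_finsetSum_le fun i hi => (totalDegree_mul _ _).trans ?_
  rw [totalDegree_C, zero_add]
  refine (totalDegree_mul _ _).trans ((add_le_add (hlin 1 i) (hlin 0 (t - i))).trans ?_)
  rw [Finset.mem_range] at hi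
  omega

theorem eval_centredForm_smul (t : ℕ) (p : Polynomial L) (y v : Fin 2 → L) (s : L) :
    eval (y + s • v) (centredForm t p y) = s ^ t * eval (y + v) (centredForm t p y) := by
  simp only [centredForm, map_sum, map_mul, map_pow, map_sub, eval_C, eval_X, Pi.add_apply,
    Pi.smul_apply, smul_eq_mul, add_sub_cancel_left, Finset.mul_sum]
  refine Finset.sum_congr rfl fun i hi => ?_
  rw [Finset.mem_range] at hi
  rw [mul_pow, mul_pow, ← Nat.add_sub_cancel' (Nat.lt_succ_iff.1 hi), pow_add s,
    Nat.add_sub_cancel_left]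
  ring

theorem eval_centredForm {t : ℕ} {p : Polynomial L} (hp : p.natDegree ≤ t) {x y : Fin 2 → L}
    (h : x 0 ≠ y 0) : eval x (centredForm t p y)
      = (x 0 - y 0) ^ t * p.eval ((x 1 - y 1) / (x 0 - y 0)) := by
  have h0 := sub_ne_zero.2 h
  simp only [centredForm, map_sum, map_mul, map_pow, map_sub, eval_C, eval_X]
  rw [Polynomial.eval_eq_sum_range' (Nat.lt_succ_of_le hp), Finset.mul_sum]
  refine Finset.sum_congr rfl fun i hi => ?_
  rw [Finset.mem_range] at hi
  rw [div_pow, ← Nat.add_sub_cancel' (Nat.lt_succ_iff.1 hi), pow_add (x 0 - y 0),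
    Nat.add_sub_cancel_left]
  field_simp

/-- A set `R` of representatives of the points of an arc over a finite field `F`, given in affine
coordinates `P` over an extension field `L`. -/
structure AffineArc (R : Finset (Fin 3 → F)) (A B O : Fin 3 → L) (c : (Fin 3 → F) → L)
    (P : (Fin 3 → F) → Fin 2 → L) : Prop where
  weight_ne_zero : ∀ Y ∈ R, c Y ≠ 0
  coord : ∀ Y ∈ R, ∀ i, c Y * algebraMap F L (Y i) = O i + P Y 0 * A i + P Y 1 * B i
  det_ne_zero : ∀ X ∈ R, ∀ Y ∈ R, ∀ Z ∈ R, X ≠ Y → X ≠ Z → Y ≠ Z → det₃ X Y Z ≠ 0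
  det_B_ne_zero : ∀ X ∈ R, ∀ Y ∈ R, X ≠ Y →
    det₃ (algebraMap F L ∘ X) (algebraMap F L ∘ Y) B ≠ 0

namespace AffineArc

variable {R : Finset (Fin 3 → F)} {A B O : Fin 3 → L} {c : (Fin 3 → F) → L}
  {P : (Fin 3 → F) → Fin 2 → L}

theorem coord_ne (h : AffineArc R A B O c P) {X Y : Fin 3 → F} (hX : X ∈ R) (hY : Y ∈ R)
    (hXY : X ≠ Y) : P X 0 ≠ P Y 0 := by
  intro h0
  refine mul_ne_zero (h.weight_ne_zero X hX) (h.det_B_ne_zero X hX Y hY hXY) ?_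
  have hc := h.weight_ne_zero Y hY
  have e : ∀ i, c X * algebraMap F L (X i) = c Y * algebraMap F L (Y i)
      + (P X 1 - P Y 1) * B i := fun i => by
    rw [h.coord X hX, h.coord Y hY, h0]; ring
  simp only [det₃, Function.comp_apply]
  linear_combination (algebraMap F L (Y 1) * B 2 - algebraMap F L (Y 2) * B 1) * e 0
    - (algebraMap F L (Y 0) * B 2 - algebraMap F L (Y 2) * B 0) * e 1
    + (algebraMap F L (Y 0) * B 1 - algebraMap F L (Y 1) * B 0) * e 2

/-- The slope of the line joining two points of the arc. -/
noncomputable def slope (P : (Fin 3 → F) → Fin 2 → L) (Y Z : Fin 3 → F) : L :=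
  (P Z 1 - P Y 1) / (P Z 0 - P Y 0)

theorem slope_spec (h : AffineArc R A B O c P) {Y Z : Fin 3 → F} (hY : Y ∈ R) (hZ : Z ∈ R)
    (hYZ : Y ≠ Z) (i : Fin 3) : A i + slope P Y Z * B i =
      (c Z * algebraMap F L (Z i) - c Y * algebraMap F L (Y i)) / (P Z 0 - P Y 0) := by
  have h0 := sub_ne_zero.2 (h.coord_ne hZ hY hYZ.symm)
  rw [h.coord Z hZ, h.coord Y hY, slope]
  field_simp
  ring

theorem slope_ne (h : AffineArc R A B O c P) {Y Z X : Fin 3 → F} (hY : Y ∈ R) (hZ : Z ∈ R)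
    (hX : X ∈ R) (hYZ : Y ≠ Z) (hYX : Y ≠ X) (hZX : Z ≠ X) : slope P Y Z ≠ slope P Y X := by
  intro hs
  have hz := sub_ne_zero.2 (h.coord_ne hZ hY hYZ.symm)
  have hx := sub_ne_zero.2 (h.coord_ne hX hY hYX.symm)
  have e : ∀ i, (P X 0 - P Y 0) * (c Z * algebraMap F L (Z i) - c Y * algebraMap F L (Y i)) =
      (P Z 0 - P Y 0) * (c X * algebraMap F L (X i) - c Y * algebraMap F L (Y i)) := fun i => by
    have := h.slope_spec hY hZ hYZ i
    rw [hs, h.slope_spec hY hX hYX i] at this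
    field_simp at this
    linear_combination -this
  have hdet : det₃ (algebraMap F L ∘ Y) (algebraMap F L ∘ Z) (algebraMap F L ∘ X) ≠ 0 := by
    rw [← map_det₃]
    exact (map_ne_zero _).2 (h.det_ne_zero Y hY Z hZ X hX hYZ hYX hZX)
  refine mul_ne_zero (mul_ne_zero hx (h.weight_ne_zero Z hZ)) hdet ?_
  simp only [det₃, Function.comp_apply]
  generalize algebraMap F L = g at *
  linear_combination (-(g (Y 1) * g (X 2) - g (Y 2) * g (X 1))) * e 0
    + (g (Y 0) * g (X 2) - g (Y 2) * g (X 0)) * e 1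
    - (g (Y 0) * g (X 1) - g (Y 1) * g (X 0)) * e 2

/-- The polynomial vanishing at the slope of the line joining `Y` and `Z`. -/
noncomputable def linePoly (A B : Fin 3 → L) (Y Z : Fin 3 → F) : Polynomial L :=
  det₃ (fun i => Polynomial.C (algebraMap F L (Y i))) (fun i => Polynomial.C (algebraMap F L (Z i)))
    (fun i => Polynomial.C (A i) + Polynomial.C (B i) * Polynomial.X)

theorem linePoly_eq (h : AffineArc R A B O c P) {Y Z : Fin 3 → F} (hY : Y ∈ R) (hZ : Z ∈ R)
    (hYZ : Y ≠ Z) : linePoly A B Y Z =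
      Polynomial.C (det₃ (algebraMap F L ∘ Y) (algebraMap F L ∘ Z) B)
      * (Polynomial.X - Polynomial.C (slope P Y Z)) := by
  have h0 : det₃ (algebraMap F L ∘ Y) (algebraMap F L ∘ Z) A
      = -(det₃ (algebraMap F L ∘ Y) (algebraMap F L ∘ Z) B * slope P Y Z) := by
    have e := h.slope_spec hY hZ hYZ
    simp only [det₃, Function.comp_apply]
    generalize algebraMap F L = g at *
    linear_combination (g (Y 1) * g (Z 2) - g (Y 2) * g (Z 1)) * e 0
      - (g (Y 0) * g (Z 2) - g (Y 2) * g (Z 0)) * e 1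
      + (g (Y 0) * g (Z 1) - g (Y 1) * g (Z 0)) * e 2
  have h1 : linePoly A B Y Z = Polynomial.C (det₃ (algebraMap F L ∘ Y) (algebraMap F L ∘ Z) A)
      + Polynomial.C (det₃ (algebraMap F L ∘ Y) (algebraMap F L ∘ Z) B) * Polynomial.X := by
    simp only [linePoly, det₃, Function.comp_apply, map_add, map_sub, map_mul]
    ring
  rw [h1, h0, map_neg, map_mul]
  ring

theorem eval_linePoly (h : AffineArc R A B O c P) {X Y : Fin 3 → F} (hX : X ∈ R) (hY : Y ∈ R)
    (hYX : Y ≠ X) (Z : Fin 3 → F) : (linePoly A B Y Z).eval (slope P Y X) =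
      c X / (P X 0 - P Y 0) * algebraMap F L (det₃ Y Z X) := by
  have e := h.slope_spec hY hX hYX
  simp only [linePoly, det₃, Polynomial.eval_add, Polynomial.eval_sub, Polynomial.eval_mul,
    Polynomial.eval_C, Polynomial.eval_X, map_add, map_sub, map_mul, mul_comm (B _)]
  rw [e 0, e 1, e 2]
  ring

variable [Fintype F]

/-- The polynomial whose roots are the slopes of the lines through `Y` defined over `F`. -/
noncomputable def slopePoly (A B : Fin 3 → L) (Y : Fin 3 → F) : Polynomial L :=
  det₃ (fun i => Polynomial.C (algebraMap F L (Y i)))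
    (fun i => Polynomial.C (A i ^ Fintype.card F)
      + Polynomial.C (B i ^ Fintype.card F) * Polynomial.X ^ Fintype.card F)
    (fun i => Polynomial.C (A i) + Polynomial.C (B i) * Polynomial.X)

theorem natDegree_slopePoly_le (A B : Fin 3 → L) (Y : Fin 3 → F) :
    (slopePoly A B Y).natDegree ≤ Fintype.card F + 1 := by
  refine (natDegree_det₃_le (i := 0) (j := Fintype.card F) (k := 1) (by simp) (fun l => ?_)
    fun l => ?_).trans_eq (zero_add _)
  · exact Polynomial.natDegree_add_le_of_degree_le (by simp)
      (Polynomial.natDegree_C_mul_X_pow_le _ _)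
  · exact Polynomial.natDegree_add_le_of_degree_le (by simp)
      (by simpa using Polynomial.natDegree_C_mul_X_pow_le (B l) 1)

theorem slope_spec_pow (h : AffineArc R A B O c P) {Y Z : Fin 3 → F} (hY : Y ∈ R) (hZ : Z ∈ R)
    (hYZ : Y ≠ Z) (i : Fin 3) :
    A i ^ Fintype.card F + B i ^ Fintype.card F * slope P Y Z ^ Fintype.card F =
      (c Z ^ Fintype.card F * algebraMap F L (Z i) - c Y ^ Fintype.card F * algebraMap F L (Y i))
        / (P Z 0 - P Y 0) ^ Fintype.card F := by
  have := congrArg (FiniteField.frobeniusAlgHom F L) (h.slope_spec hY hZ hYZ i)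
  have hden : (P Z 0 - P Y 0) ^ Fintype.card F = P Z 0 ^ Fintype.card F - P Y 0 ^ Fintype.card F :=
    map_sub (FiniteField.frobeniusAlgHom F L) _ _
  rw [hden]
  simpa only [map_add, map_mul, map_div₀, map_sub, AlgHom.commutes,
    FiniteField.coe_frobeniusAlgHom, mul_comm (_ ^ _) (B i ^ _)] using this

theorem eval_slopePoly (h : AffineArc R A B O c P) {X Y : Fin 3 → F} (hX : X ∈ R) (hY : Y ∈ R)
    (hYX : Y ≠ X) : (slopePoly A B Y).eval (slope P Y X) = 0 := by
  have e := h.slope_spec hY hX hYX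
  have e' := h.slope_spec_pow hY hX hYX
  simp only [slopePoly, det₃, Polynomial.eval_add, Polynomial.eval_sub, Polynomial.eval_mul,
    Polynomial.eval_pow, Polynomial.eval_C, Polynomial.eval_X, mul_comm (B _) (slope _ _ _)]
  rw [e 0, e 1, e 2, e' 0, e' 1, e' 2]
  ring

theorem eval_derivative_slopePoly (h : AffineArc R A B O c P) {X Y : Fin 3 → F} (hX : X ∈ R)
    (hY : Y ∈ R) (hYX : Y ≠ X) : (slopePoly A B Y).derivative.eval (slope P Y X) =
      (c X / (P X 0 - P Y 0)) ^ Fintype.card F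
        * det₃ (algebraMap F L ∘ Y) (algebraMap F L ∘ X) B := by
  have e' := h.slope_spec_pow hY hX hYX
  have hq : (Fintype.card F : L) = 0 := by
    rw [← map_natCast (algebraMap F L), FiniteField.cast_card_eq_zero, map_zero]
  simp only [slopePoly, det₃, Polynomial.derivative_add, Polynomial.derivative_sub,
    Polynomial.derivative_mul, Polynomial.derivative_C, Polynomial.derivative_X_pow,
    Polynomial.derivative_X, Polynomial.eval_add, Polynomial.eval_sub, Polynomial.eval_mul,
    Polynomial.eval_pow, Polynomial.eval_C, Polynomial.eval_X, hq, map_zero, zero_mul, mul_zero,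
    zero_add, add_zero, mul_one, Function.comp_apply]
  rw [e' 0, e' 1, e' 2, div_pow]
  ring

theorem exists_slope_factor (h : AffineArc R A B O c P) {t : ℕ} (hcard : R.card + t =
    Fintype.card F + 2) {Y : Fin 3 → F} (hY : Y ∈ R) [DecidableEq (Fin 3 → F)] :
    ∃ p : Polynomial L, p.natDegree ≤ t ∧
      slopePoly A B Y = p * ∏ Z ∈ R.erase Y, linePoly A B Y Z := by
  have hne : ∀ Z ∈ R.erase Y, Z ∈ R ∧ Y ≠ Z := fun Z hZ =>
    ⟨Finset.mem_of_mem_erase hZ, (Finset.ne_of_mem_erase hZ).symm⟩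
  have hdvd : ∏ Z ∈ R.erase Y, (Polynomial.X - Polynomial.C (slope P Y Z)) ∣ slopePoly A B Y := by
    refine Finset.prod_dvd_of_coprime (fun Z hZ X hX hZX => ?_) fun Z hZ => ?_
    · have hZ' := hne Z hZ
      have hX' := hne X hX
      exact Polynomial.isCoprime_X_sub_C_of_isUnit_sub (sub_ne_zero.2
        (h.slope_ne hY hZ'.1 hX'.1 hZ'.2 hX'.2 hZX)).isUnit
    · rw [Polynomial.dvd_iff_isRoot]
      exact h.eval_slopePoly (hne Z hZ).1 hY (hne Z hZ).2
  obtain ⟨r, hr⟩ := hdvd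
  have hb : ∏ Z ∈ R.erase Y, det₃ (algebraMap F L ∘ Y) (algebraMap F L ∘ Z) B ≠ 0 :=
    Finset.prod_ne_zero_iff.2 fun Z hZ => h.det_B_ne_zero Y hY Z (hne Z hZ).1 (hne Z hZ).2
  refine ⟨Polynomial.C (∏ Z ∈ R.erase Y, det₃ (algebraMap F L ∘ Y) (algebraMap F L ∘ Z) B)⁻¹ * r,
    (Polynomial.natDegree_C_mul_le _ _).trans ?_, ?_⟩
  · rcases eq_or_ne r 0 with rfl | hr0
    · simp
    have hdeg := natDegree_slopePoly_le A B Y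
    rw [hr, (Polynomial.monic_prod_of_monic _ _ fun Z _ =>
      Polynomial.monic_X_sub_C _).natDegree_mul' hr0, Polynomial.natDegree_prod_of_monic _ _
        fun Z _ => Polynomial.monic_X_sub_C _] at hdeg
    simp only [Polynomial.natDegree_X_sub_C, Finset.sum_const, smul_eq_mul, mul_one] at hdeg
    rw [Finset.card_erase_of_mem hY] at hdeg
    have := Finset.card_pos.2 ⟨Y, hY⟩
    omega
  · rw [Finset.prod_congr rfl fun Z hZ => h.linePoly_eq hY (hne Z hZ).1 (hne Z hZ).2,
      Finset.prod_mul_distrib, ← map_prod, hr]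
    have : Polynomial.C (∏ Z ∈ R.erase Y, det₃ (algebraMap F L ∘ Y) (algebraMap F L ∘ Z) B)⁻¹ *
        Polynomial.C (∏ Z ∈ R.erase Y, det₃ (algebraMap F L ∘ Y) (algebraMap F L ∘ Z) B) = 1 := by
      rw [← map_mul, inv_mul_cancel₀ hb, map_one]
    linear_combination (-(r * ∏ Z ∈ R.erase Y, (Polynomial.X - Polynomial.C (slope P Y Z)))) * this

/-- Segre's lemma of tangents. -/
theorem exists_tangent_forms (h : AffineArc R A B O c P) {t : ℕ}
    (hcard : R.card + t = Fintype.card F + 2) [DecidableEq (Fin 3 → F)] :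
    ∃ f : (Fin 3 → F) → MvPolynomial (Fin 2) L, (∀ Y, (f Y).totalDegree ≤ t) ∧
      (∀ Y v (s : L), eval (P Y + s • v) (f Y) = s ^ t * eval (P Y + v) (f Y)) ∧
      ∀ Y ∈ R, ∀ X ∈ R, Y ≠ X → eval (P X) (f Y) *
        ∏ Z ∈ (R.erase Y).erase X, algebraMap F L (det₃ Y Z X) = (c X * c Y) ^ t := by
  have hp : ∀ Y, ∃ p : Polynomial L, Y ∈ R → p.natDegree ≤ t ∧
      slopePoly A B Y = p * ∏ Z ∈ R.erase Y, linePoly A B Y Z := fun Y => by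
    by_cases hY : Y ∈ R
    · exact (h.exists_slope_factor hcard hY).imp fun p hp _ => hp
    · exact ⟨0, fun h => (hY h).elim⟩
  choose p hp using hp
  refine ⟨fun Y => C (c Y ^ t) * centredForm t (p Y) (P Y), fun Y => ?_, fun Y v s => ?_,
    fun Y hY X hX hYX => ?_⟩
  · exact (totalDegree_mul _ _).trans
      (by rw [totalDegree_C, zero_add]; exact totalDegree_centredForm_le _ _ _)
  · simp only [map_mul, eval_C, eval_centredForm_smul]
    ring
  · have hv := sub_ne_zero.2 (h.coord_ne hX hY hYX.symm)
    have hX' : X ∈ R.erase Y := Finset.mem_erase.2 ⟨hYX.symm, hX⟩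
    have hb := h.det_B_ne_zero Y hY X hX hYX
    have hder := h.eval_derivative_slopePoly hX hY hYX
    rw [(hp Y hY).2, ← Finset.prod_erase_mul _ _ hX', ← mul_assoc, Polynomial.derivative_mul,
      h.linePoly_eq hY hX hYX] at hder
    simp only [Polynomial.derivative_mul, Polynomial.derivative_C, Polynomial.derivative_sub,
      Polynomial.derivative_X, Polynomial.eval_add, Polynomial.eval_mul, Polynomial.eval_C,
      Polynomial.eval_sub, Polynomial.eval_X, sub_self, mul_zero, zero_mul, zero_add, sub_zero,
      mul_one, Polynomial.eval_prod] at hder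
    have hder := mul_right_cancel₀ hb hder
    simp only [h.eval_linePoly hX hY hYX] at hder
    have hcardR : ((R.erase Y).erase X).card + t = Fintype.card F := by
      have h1 := Finset.card_erase_of_mem hX'
      have h2 := Finset.card_erase_of_mem hY
      have h3 := Finset.card_pos.2 ⟨X, hX'⟩
      omega
    rw [Finset.prod_mul_distrib, Finset.prod_const, ← hcardR, pow_add] at hder
    have hcX : (c X / (P X 0 - P Y 0)) ^ ((R.erase Y).erase X).card ≠ 0 :=
      pow_ne_zero _ (div_ne_zero (h.weight_ne_zero X hX) hv)
    have hmain : (p Y).eval (slope P Y X) * ∏ Z ∈ (R.erase Y).erase X,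
        algebraMap F L (det₃ Y Z X) = (c X / (P X 0 - P Y 0)) ^ t :=
      mul_left_cancel₀ hcX (by linear_combination hder)
    rw [map_mul, eval_C, eval_centredForm (hp Y hY).1 (h.coord_ne hX hY hYX.symm)]
    change c Y ^ t * ((P X 0 - P Y 0) ^ t * (p Y).eval (slope P Y X)) * _ = _
    rw [mul_assoc, mul_assoc, hmain, ← mul_pow, mul_div_cancel₀ _ hv, ← mul_pow, mul_comm]

end AffineArc

end Segre

section ArcBound

variable {F L : Type*} [Field F] [Field L] [Algebra F L]

theorem exists_homogenization {σ : Type*} {n : ℕ} {φ : MvPolynomial (Fin 2) L}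
    (hφ : φ.totalDegree ≤ n) {m₀ m₁ l : MvPolynomial σ L} (h₀ : m₀.IsHomogeneous 1)
    (h₁ : m₁.IsHomogeneous 1) (hl : l.IsHomogeneous 1) :
    ∃ Q : MvPolynomial σ L, Q.IsHomogeneous n ∧ ∀ Y (x : Fin 2 → L) w, eval Y m₀ = w * x 0 →
      eval Y m₁ = w * x 1 → eval Y l = w → eval Y Q = w ^ n * eval x φ := by
  have hle : ∀ e ∈ φ.support, e 0 + e 1 ≤ n := fun e he => by
    have := (le_totalDegree he).trans hφ
    rwa [Finsupp.sum_fintype _ _ fun _ => rfl, Fin.sum_univ_two] at this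
  refine ⟨∑ e ∈ φ.support, C (coeff e φ) * (m₀ ^ e 0 * m₁ ^ e 1 * l ^ (n - (e 0 + e 1))),
    IsHomogeneous.sum _ _ _ fun e he => ?_, fun Y x w hx₀ hx₁ hw => ?_⟩
  · have := (isHomogeneous_C σ (coeff e φ)).mul
      (((h₀.pow (e 0)).mul (h₁.pow (e 1))).mul (hl.pow (n - (e 0 + e 1))))
    rwa [one_mul, one_mul, one_mul, zero_add, Nat.add_sub_cancel' (hle e he)] at this
  · rw [eval_eq' x φ, map_sum, Finset.mul_sum]
    refine Finset.sum_congr rfl fun e he => ?_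
    simp only [map_mul, map_pow, eval_C, hx₀, hx₁, hw, Fin.prod_univ_two]
    rw [mul_pow, mul_pow, ← Nat.add_sub_cancel' (hle e he), pow_add, pow_add,
      Nat.add_sub_cancel_left]
    ring

theorem exists_form_over_subfield {σ : Type*} [Fintype σ] {n : ℕ} {Q : MvPolynomial σ L}
    (hQ : Q ≠ 0) (hn : Q.IsHomogeneous n) : ∃ Q' : MvPolynomial σ F, Q' ≠ 0 ∧ Q'.IsHomogeneous n ∧
      ∀ Y : σ → F, eval (algebraMap F L ∘ Y) Q = 0 → eval Y Q' = 0 := by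
  classical
  obtain ⟨d, hd⟩ := ne_zero_iff.1 hQ
  obtain ⟨g, hg⟩ : ∃ g : Module.Dual F L, g (coeff d Q) ≠ 0 := by
    by_contra! h
    exact hd ((Module.forall_dual_apply_eq_zero_iff F _).1 h)
  refine ⟨∑ e ∈ Q.support, monomial e (g (coeff e Q)), fun h => hg ?_,
    IsHomogeneous.sum _ _ _ fun e he => isHomogeneous_monomial _ ?_, fun Y hY => ?_⟩
  · have := congrArg (coeff d) h
    simpa [coeff_sum, coeff_monomial, hd] using this
  · rw [Finsupp.degree_eq_weight_one]
    exact hn (mem_support_iff.1 he)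
  · rw [map_sum, ← map_zero g, ← hY, eval_eq', map_sum]
    refine Finset.sum_congr rfl fun e _ => ?_
    rw [eval_monomial, Finsupp.prod_fintype _ _ fun _ => pow_zero _, mul_comm, ← smul_eq_mul,
      ← map_smul, Algebra.smul_def, mul_comm, map_prod]
    simp only [map_pow, Function.comp_apply]

/-- The coordinates of a point in the chart with origin `(0, 0, 1)`, directions
`(θ³, θ² + θ⁴, 0)` and `(1, θ, θ²)`; the last one is the weight. -/
noncomputable def chartForm (θ : L) : Fin 3 → MvPolynomial (Fin 3) L :=
  let l := X 2 + C (θ ^ 3) * X 1 - C (θ ^ 2 + θ ^ 4) * X 0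
  let m := C (θ ^ 2)⁻¹ * (X 2 - l)
  ![C (θ ^ 3)⁻¹ * (X 0 - m), m, l]

theorem isHomogeneous_chartForm (θ : L) (i : Fin 3) : (chartForm θ i).IsHomogeneous 1 := by
  have hX : ∀ j, (X j : MvPolynomial (Fin 3) L).IsHomogeneous 1 := isHomogeneous_X L
  have hC : ∀ a : L, ∀ {p : MvPolynomial (Fin 3) L}, p.IsHomogeneous 1 →
      (C a * p).IsHomogeneous 1 := fun a p hp => by
    simpa using (isHomogeneous_C (Fin 3) a).mul hp
  have hl := ((hX 2).add (hC (θ ^ 3) (hX 1))).sub (hC (θ ^ 2 + θ ^ 4) (hX 0))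
  have hm := hC (θ ^ 2)⁻¹ ((hX 2).sub hl)
  fin_cases i
  exacts [hC _ ((hX 0).sub hm), hm, hl]

theorem chartForm_eval {θ : L} (hθ : θ ≠ 0) (Y : Fin 3 → L) (i : Fin 3) :
    Y i = eval Y (chartForm θ 2) * ![0, 0, 1] i
      + eval Y (chartForm θ 0) * ![θ ^ 3, θ ^ 2 + θ ^ 4, 0] i
      + eval Y (chartForm θ 1) * ![1, θ, θ ^ 2] i := by
  fin_cases i <;> simp [chartForm] <;> field_simp <;> ring

theorem exists_chartForm_eval {θ : L} (hθ : θ ≠ 0) (x : Fin 2 → L) :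
    ∃ Y, eval Y (chartForm θ 0) = x 0 ∧ eval Y (chartForm θ 1) = x 1 ∧
      eval Y (chartForm θ 2) = 1 := by
  refine ⟨![x 0 * θ ^ 3 + x 1, x 0 * (θ ^ 2 + θ ^ 4) + x 1 * θ, 1 + x 1 * θ ^ 2], ?_, ?_, ?_⟩ <;>
    simp [chartForm] <;> field_simp <;> ring

theorem chartForm_two_ne_zero {θ : L} (hθ : Transcendental F θ) {Y : Fin 3 → F} (hY : Y ≠ 0) :
    eval (algebraMap F L ∘ Y) (chartForm θ 2) ≠ 0 := by
  intro h
  have := transcendental_iff.1 hθ (Polynomial.C (Y 2) + Polynomial.C (Y 1) * Polynomial.X ^ 3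
    - Polynomial.C (Y 0) * Polynomial.X ^ 2 - Polynomial.C (Y 0) * Polynomial.X ^ 4) (by
      simp [chartForm] at h ⊢
      linear_combination h)
  refine hY (funext fun i => ?_)
  fin_cases i
  · simpa [Polynomial.coeff_X, Polynomial.coeff_C, Polynomial.coeff_X_pow]
      using congrArg (Polynomial.coeff · 2) this
  · simpa [Polynomial.coeff_X, Polynomial.coeff_C, Polynomial.coeff_X_pow]
      using congrArg (Polynomial.coeff · 3) this
  · simpa [Polynomial.coeff_X, Polynomial.coeff_C, Polynomial.coeff_X_pow]
      using congrArg (Polynomial.coeff · 0) this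

theorem det₃_transcendental_ne_zero {θ : L} (hθ : Transcendental F θ) {X Y Z : Fin 3 → F}
    (h : det₃ X Y Z ≠ 0) :
    det₃ (algebraMap F L ∘ X) (algebraMap F L ∘ Y) ![1, θ, θ ^ 2] ≠ 0 := by
  intro h0
  have := transcendental_iff.1 hθ (Polynomial.C (X 1 * Y 2 - X 2 * Y 1)
    + Polynomial.C (X 2 * Y 0 - X 0 * Y 2) * Polynomial.X
    + Polynomial.C (X 0 * Y 1 - X 1 * Y 0) * Polynomial.X ^ 2) (by
      simp [det₃] at h0 ⊢
      linear_combination h0)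
  have e0 : X 1 * Y 2 - X 2 * Y 1 = 0 := by
    simpa [Polynomial.coeff_X, -map_sub, -map_mul, Polynomial.coeff_X_pow]
      using congrArg (Polynomial.coeff · 0) this
  have e1 : X 2 * Y 0 - X 0 * Y 2 = 0 := by
    simpa [Polynomial.coeff_X, Polynomial.coeff_C, -map_sub, -map_mul, Polynomial.coeff_X_pow]
      using congrArg (Polynomial.coeff · 1) this
  have e2 : X 0 * Y 1 - X 1 * Y 0 = 0 := by
    simpa [Polynomial.coeff_X, Polynomial.coeff_C, -map_sub, -map_mul, Polynomial.coeff_X_pow]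
      using congrArg (Polynomial.coeff · 2) this
  refine h ?_
  rw [det₃]
  linear_combination Z 0 * e0 + Z 1 * e1 + Z 2 * e2

theorem card_le_of_affineChart [Fintype F] [IsAlgClosed L] {θ : L} (hθ : Transcendental F θ)
    (hodd : Odd (Fintype.card F)) {R : Finset (Fin 3 → F)} {t : ℕ} (h3 : 3 ≤ R.card)
    (hcard : R.card + t = Fintype.card F + 2)
    (hdet : ∀ X ∈ R, ∀ Y ∈ R, ∀ Z ∈ R, X ≠ Y → X ≠ Z → Y ≠ Z → det₃ X Y Z ≠ 0)
    (hconic : ∀ Q : MvPolynomial (Fin 3) F, Q ≠ 0 → Q.IsHomogeneous 2 →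
      ∀ T ⊆ R, (∀ Y ∈ T, eval Y Q = 0) → T.card ≤ 5) : R.card ≤ 10 * t ^ 2 := by
  classical
  have hθ0 : θ ≠ 0 := fun h => hθ (h ▸ isAlgebraic_zero)
  have hthird : ∀ X ∈ R, ∀ Y ∈ R, X ≠ Y → ∃ Z, det₃ X Y Z ≠ 0 := fun X hX Y hY hXY => by
    obtain ⟨Z, hZ, hZ'⟩ := Finset.exists_mem_notMem_of_card_lt_card (s := {X, Y}) (t := R)
      ((Finset.card_le_two).trans_lt h3)
    simp only [Finset.mem_insert, Finset.mem_singleton, not_or] at hZ'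
    exact ⟨Z, hdet X hX Y hY Z hZ hXY (Ne.symm hZ'.1) (Ne.symm hZ'.2)⟩
  let w : (Fin 3 → F) → Fin 3 → L := fun Y i => eval (algebraMap F L ∘ Y) (chartForm θ i)
  have hw : ∀ Y ∈ R, w Y 2 ≠ 0 := fun Y hY => chartForm_two_ne_zero hθ fun h0 => by
    obtain ⟨X, hX, hXY⟩ := Finset.exists_mem_ne (show 1 < R.card by omega) Y
    obtain ⟨Z, hZ⟩ := hthird X hX Y hY hXY
    exact hZ (by simp [det₃, h0])
  let P : (Fin 3 → F) → Fin 2 → L := fun Y => ![w Y 0 / w Y 2, w Y 1 / w Y 2]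
  have hA : AffineArc R ![θ ^ 3, θ ^ 2 + θ ^ 4, 0] ![1, θ, θ ^ 2] ![0, 0, 1]
      (fun Y => (w Y 2)⁻¹) P :=
    { weight_ne_zero := fun Y hY => inv_ne_zero (hw Y hY)
      coord := fun Y hY i => by
        have h2 := hw Y hY
        have := chartForm_eval hθ0 (algebraMap F L ∘ Y) i
        rw [Function.comp_apply] at this
        change _ = w Y 2 * _ + w Y 0 * _ + w Y 1 * _ at this
        rw [this]
        simp only [P, Matrix.cons_val_zero, Matrix.cons_val_one]
        field_simp
      det_ne_zero := hdet
      det_B_ne_zero := fun X hX Y hY hXY =>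
        (hthird X hX Y hY hXY).elim fun Z hZ => det₃_transcendental_ne_zero hθ hZ }
  obtain ⟨f, hfdeg, hfhom, hf⟩ := hA.exists_tangent_forms hcard
  have hinj : Set.InjOn P R := fun X hX Y hY h => by
    by_contra hXY
    exact hA.coord_ne hX hY hXY (by rw [h])
  let ι := Function.invFunOn P (R : Set (Fin 3 → F))
  have hι : ∀ Y ∈ R, ι (P Y) = Y := fun Y hY => hinj.leftInvOn_invFunOn hY
  have hcardS : (R.image P).card = R.card := Finset.card_image_of_injOn hinj
  have hprod : ∀ Y ∈ R, ∀ X ∈ R, Y ≠ X →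
      ∏ Z ∈ (R.erase Y).erase X, algebraMap F L (det₃ Y Z X) ≠ 0 := fun Y hY X hX hYX =>
    Finset.prod_ne_zero_iff.2 fun Z hZ => by
      simp only [Finset.mem_erase] at hZ
      exact (map_ne_zero _).2 (hdet Y hY Z hZ.2.2 X hX (Ne.symm hZ.2.1) hYX hZ.1)
  have hweight : ∀ Y ∈ R, ∀ X ∈ R, ((w X 2)⁻¹ * (w Y 2)⁻¹) ^ t ≠ 0 := fun Y hY X hX =>
    pow_ne_zero _ (mul_ne_zero (inv_ne_zero (hw X hX)) (inv_ne_zero (hw Y hY)))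
  have hT : TangentSystem (R.image P) t fun y => f (ι y) := by
    refine ⟨fun y _ => hfdeg _, ?_, ?_, ?_⟩ <;> simp only [Finset.forall_mem_image]
    · intro Y hY s v
      rw [hι Y hY]
      exact hfhom Y v s
    · intro X hX Y hY hXY
      have hne : Y ≠ X := fun h => hXY (by rw [h])
      rw [hι X hX, hι Y hY]
      have h1 := hf Y hY X hX hne
      have h2 := hf X hX Y hY hne.symm
      have hcardR : ((R.erase Y).erase X).card + t = Fintype.card F := by
        have h1 := Finset.card_erase_of_mem (Finset.mem_erase.2 ⟨hne.symm, hX⟩ : X ∈ R.erase Y)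
        have h2 := Finset.card_erase_of_mem hY
        omega
      have hsign : ∏ Z ∈ (R.erase X).erase Y, algebraMap F L (det₃ X Z Y)
          = (-1) ^ (t + 1) * ∏ Z ∈ (R.erase Y).erase X, algebraMap F L (det₃ Y Z X) := by
        have hpar : (-1 : L) ^ (t + 1) = (-1) ^ ((R.erase Y).erase X).card := by
          rw [neg_one_pow_eq_pow_mod_two, neg_one_pow_eq_pow_mod_two (Finset.card _)]
          congr 1
          obtain ⟨m, hm⟩ := hodd
          omega
        rw [hpar, ← Finset.prod_const, ← Finset.prod_mul_distrib, Finset.erase_right_comm]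
        refine Finset.prod_congr rfl fun Z _ => ?_
        simp only [det₃, map_add, map_sub, map_mul]
        ring
      rw [hsign, mul_comm (w Y 2)⁻¹, ← h1] at h2
      exact mul_right_cancel₀ (hprod Y hY X hX hne) (by linear_combination -h2)
    · intro X hX Y hY hXY h0
      have hne : Y ≠ X := fun h => hXY (by rw [h])
      rw [hι Y hY] at h0
      have := hf Y hY X hX hne
      rw [h0, zero_mul] at this
      exact hweight Y hY X hX this.symm
  obtain ⟨p, hp⟩ := CharP.exists F
  have hpp : p.Prime := (FiniteField.card F p).choose_spec.1
  have : Fact p.Prime := ⟨hpp⟩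
  have : CharP L p := charP_of_injective_algebraMap (algebraMap F L).injective p
  have h2 : (2 : L) ≠ 0 := by
    refine Ring.two_ne_zero fun h => ?_
    have : ringChar F = 2 := by
      rw [← h, ringChar.eq L p, ringChar.eq F p]
    have := FiniteField.even_card_iff_char_two.1 this
    rw [Nat.odd_iff] at hodd
    omega
  by_contra! hlt
  refine hT.false_of_conics (p := p) h2 (hcardS ▸ h3) (hcardS ▸ hlt) fun φ hφ hdeg T hTS hT0 => ?_
  obtain ⟨Q, hQ, hQe⟩ := exists_homogenization hdeg (isHomogeneous_chartForm θ 0)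
    (isHomogeneous_chartForm θ 1) (isHomogeneous_chartForm θ 2)
  have hQ0 : Q ≠ 0 := by
    rintro rfl
    refine hφ (MvPolynomial.funext fun x => ?_)
    obtain ⟨Y, h0, h1, h2⟩ := exists_chartForm_eval hθ0 x
    simpa using (hQe Y x 1 (by rw [h0, one_mul]) (by rw [h1, one_mul]) h2).symm
  obtain ⟨Q', hQ'0, hQ', hQ'e⟩ := exists_form_over_subfield (F := F) hQ0 hQ
  obtain ⟨T', hT', rfl⟩ := Finset.subset_image_iff.1 hTS
  refine Finset.card_image_le.trans (hconic Q' hQ'0 hQ' T' hT' fun Y hY => hQ'e Y ?_)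
  have h2 := hw Y (hT' hY)
  rw [hQe _ (P Y) (w Y 2) (mul_div_cancel₀ _ h2).symm (mul_div_cancel₀ _ h2).symm rfl,
    hT0 _ (Finset.mem_image_of_mem P hY), mul_zero]

theorem card_le_of_noncollinear [Fintype F] (hodd : Odd (Fintype.card F))
    {R : Finset (Fin 3 → F)} {t : ℕ} (h3 : 3 ≤ R.card) (hcard : R.card + t = Fintype.card F + 2)
    (hdet : ∀ X ∈ R, ∀ Y ∈ R, ∀ Z ∈ R, X ≠ Y → X ≠ Z → Y ≠ Z → det₃ X Y Z ≠ 0)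
    (hconic : ∀ Q : MvPolynomial (Fin 3) F, Q ≠ 0 → Q.IsHomogeneous 2 →
      ∀ T ⊆ R, (∀ Y ∈ T, eval Y Q = 0) → T.card ≤ 5) : R.card ≤ 10 * t ^ 2 := by
  have hθ : Transcendental F (algebraMap (RatFunc F) (AlgebraicClosure (RatFunc F)) RatFunc.X) :=
    (transcendental_algebraMap_iff
      (algebraMap (RatFunc F) (AlgebraicClosure (RatFunc F))).injective).2 RatFunc.transcendental_X
  exact card_le_of_affineChart hθ hodd h3 hcard hdet hconic

end ArcBound

section GeneralizedArc

variable {F : Type*} [Field F]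

/-- The linear form vanishing on the line through two points. -/
noncomputable def lineForm (X Y : Fin 3 → F) : MvPolynomial (Fin 3) F :=
  det₃ (fun i => C (X i)) (fun i => C (Y i)) MvPolynomial.X

theorem eval_lineForm (X Y Z : Fin 3 → F) : eval Z (lineForm X Y) = det₃ X Y Z := by
  simp [lineForm, det₃]

theorem isHomogeneous_lineForm (X Y : Fin 3 → F) : (lineForm X Y).IsHomogeneous 1 := by
  have hC : ∀ i j a, (C (X i) * (C a * MvPolynomial.X j) :
      MvPolynomial (Fin 3) F).IsHomogeneous 1 := fun i j a => by
    simpa using (isHomogeneous_C (Fin 3) (X i)).mul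
      ((isHomogeneous_C (Fin 3) a).mul (isHomogeneous_X F j))
  simp only [lineForm, det₃, mul_sub]
  exact (((hC _ _ _).sub (hC _ _ _)).sub ((hC _ _ _).sub (hC _ _ _))).add
    ((hC _ _ _).sub (hC _ _ _))

theorem exists_noncollinear_subset {R : Finset (Fin 3 → F)}
    (hne : ∀ X ∈ R, ∀ Y ∈ R, X ≠ Y → ∃ Z, det₃ X Y Z ≠ 0)
    (hconic : ∀ Q : MvPolynomial (Fin 3) F, Q ≠ 0 → Q.IsHomogeneous 2 →
      ∀ T ⊆ R, (∀ Y ∈ T, eval Y Q = 0) → T.card ≤ 5) :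
    ∃ S ⊆ R, R.card ≤ S.card + 3 ∧
      ∀ X ∈ S, ∀ Y ∈ S, ∀ Z ∈ S, X ≠ Y → X ≠ Z → Y ≠ Z → det₃ X Y Z ≠ 0 := by
  classical
  by_cases h : ∀ X ∈ R, ∀ Y ∈ R, ∀ Z ∈ R, X ≠ Y → X ≠ Z → Y ≠ Z → det₃ X Y Z ≠ 0
  · exact ⟨R, subset_rfl, Nat.le_add_right _ _, h⟩
  push Not at h
  obtain ⟨X, hX, Y, hY, Z, hZ, hXY, hXZ, hYZ, hdet⟩ := h
  have hsub : ∀ {X Y Z : Fin 3 → F}, X ∈ R → Y ∈ R → Z ∈ R → {X, Y, Z} ⊆ R := fun hX hY hZ => by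
    simp [Finset.insert_subset_iff, hX, hY, hZ]
  have hzero : ∀ {X Y Z : Fin 3 → F}, det₃ X Y Z = 0 → ∀ W ∈ ({X, Y, Z} : Finset (Fin 3 → F)),
      eval W (lineForm X Y) = 0 := fun h W hW => by
    simp only [Finset.mem_insert, Finset.mem_singleton] at hW
    rw [eval_lineForm]
    rcases hW with rfl | rfl | rfl
    · rw [det₃]; ring
    · rw [det₃]; ring
    · exact h
  have hform : ∀ {X Y : Fin 3 → F}, X ∈ R → Y ∈ R → X ≠ Y → lineForm X Y ≠ 0 :=
    fun hX hY hXY h0 => (hne _ hX _ hY hXY).elim fun Z hZ => hZ (by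
      rw [← eval_lineForm, h0, map_zero])
  refine ⟨R \ {X, Y, Z}, Finset.sdiff_subset, ?_, ?_⟩
  · have := Finset.card_sdiff_add_card_eq_card (hsub hX hY hZ)
    rw [Finset.card_eq_three.2 ⟨X, Y, Z, hXY, hXZ, hYZ, rfl⟩] at this
    exact this.ge
  · intro X' hX' Y' hY' Z' hZ' hXY' hXZ' hYZ' hdet'
    have hdisj : Disjoint ({X, Y, Z} : Finset (Fin 3 → F)) {X', Y', Z'} := by
      refine Finset.disjoint_of_subset_right ?_ Finset.disjoint_sdiff (u := R \ {X, Y, Z})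
      intro W hW
      simp only [Finset.mem_insert, Finset.mem_singleton] at hW
      rcases hW with rfl | rfl | rfl <;> assumption
    have hR := fun {W} (hW : W ∈ R \ {X, Y, Z}) => (Finset.mem_sdiff.1 hW).1
    have := hconic (lineForm X Y * lineForm X' Y')
      (mul_ne_zero (hform hX hY hXY) (hform (hR hX') (hR hY') hXY'))
      ((isHomogeneous_lineForm X Y).mul (isHomogeneous_lineForm X' Y')) _
      (Finset.union_subset (hsub hX hY hZ) (hsub (hR hX') (hR hY') (hR hZ'))) fun W hW => by
        rw [map_mul, mul_eq_zero]
        exact (Finset.mem_union.1 hW).imp (hzero hdet W) (hzero hdet' W)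
    rw [Finset.card_union_of_disjoint hdisj,
      Finset.card_eq_three.2 ⟨X, Y, Z, hXY, hXZ, hYZ, rfl⟩,
      Finset.card_eq_three.2 ⟨X', Y', Z', hXY', hXZ', hYZ', rfl⟩] at this
    omega

theorem card_le_of_forall_conic [Fintype F] (hodd : Odd (Fintype.card F))
    {R : Finset (Fin 3 → F)} (hne : ∀ X ∈ R, ∀ Y ∈ R, X ≠ Y → ∃ Z, det₃ X Y Z ≠ 0)
    (hconic : ∀ Q : MvPolynomial (Fin 3) F, Q ≠ 0 → Q.IsHomogeneous 2 →
      ∀ T ⊆ R, (∀ Y ∈ T, eval Y Q = 0) → T.card ≤ 5) :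
    (R.card : ℝ) ≤ Fintype.card F - Real.sqrt (Fintype.card F) / 4 + 19 / 4 := by
  obtain ⟨S, hSR, hRS, hS⟩ := exists_noncollinear_subset hne hconic
  have hbound : ∀ T ⊆ S, ∀ t, 3 ≤ T.card → T.card + t = Fintype.card F + 2 →
      T.card ≤ 10 * t ^ 2 := fun T hT t h3 ht =>
    card_le_of_noncollinear hodd h3 ht
      (fun X hX Y hY Z hZ => hS X (hT hX) Y (hT hY) Z (hT hZ))
      fun Q hQ hQ2 U hU => hconic Q hQ hQ2 U (hU.trans (hT.trans hSR))
  have hq : 1 < Fintype.card F := Fintype.one_lt_card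
  have hlt : S.card < Fintype.card F + 2 := by
    by_contra! h
    obtain ⟨T, hT, hTc⟩ := Finset.exists_subset_card_eq h
    have := hbound T hT 0 (by omega) hTc
    omega
  obtain ⟨t, ht⟩ := Nat.exists_eq_add_of_lt hlt
  have hs := Real.sqrt_nonneg (Fintype.card F)
  have hs2 := Real.sq_sqrt (Nat.cast_nonneg (α := ℝ) (Fintype.card F))
  generalize Fintype.card F = q at *
  set s := Real.sqrt q
  have hq' : (1 : ℝ) < q := by exact_mod_cast hq
  have hsq : s ≤ q := by nlinarith
  have hRS' : (R.card : ℝ) ≤ S.card + 3 := by exact_mod_cast hRS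
  have ht' : (q : ℝ) + 2 = S.card + t + 1 := by exact_mod_cast ht
  by_contra! hcon
  have h3 : 3 ≤ S.card := by
    have : (2 : ℝ) < S.card := by linarith
    exact_mod_cast this
  have hb : (S.card : ℝ) ≤ 10 * (t + 1) ^ 2 := by
    exact_mod_cast hbound S subset_rfl (t + 1) h3 (by omega)
  have ht0 : (0 : ℝ) ≤ t := Nat.cast_nonneg t
  have hts : 4 * (t : ℝ) + 3 < s := by linarith
  nlinarith

end GeneralizedArc

theorem Projectivization.exists_det₃_rep_ne_zero {F : Type*} [Field F] {a b : P2 F} (h : a ≠ b) :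
    ∃ Z, det₃ a.rep b.rep Z ≠ 0 := by
  by_contra! h0
  have e0 := h0 ![1, 0, 0]
  have e1 := h0 ![0, 1, 0]
  have e2 := h0 ![0, 0, 1]
  simp only [det₃, Matrix.cons_val] at e0 e1 e2
  obtain ⟨i, hi⟩ := Function.ne_iff.1 b.rep_nonzero
  refine h ?_
  rw [← a.mk_rep, ← b.mk_rep, Projectivization.mk_eq_mk_iff']
  refine ⟨a.rep i / b.rep i, funext fun j => ?_⟩
  rw [Pi.zero_apply] at hi
  rw [Pi.smul_apply, smul_eq_mul, div_mul_eq_mul_div, div_eq_iff hi]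
  generalize a.rep = u at *
  generalize b.rep = v at *
  fin_cases i <;> fin_cases j <;> simp only [Fin.reduceFinMk, Fin.mk_one, Fin.zero_eta] <;> grind

end GeneralizedArcBound

/-- for `q ≥ 7` odd, every generalized `k`-arc in `P²(F)` satisfies
`k ≤ q − √q/4 + 19/4`. -/
theorem stmt9 {F : Type*} [Field F] [Fintype F] (q : ℕ) (hq : Fintype.card F = q)
    (hodd : Odd q) (h7 : 7 ≤ q) (k : ℕ) (K : Set (P2 F))
    (hcard : K.ncard = k) (hgen : IsGenArc K) :
    (k : ℝ) ≤ (q : ℝ) - Real.sqrt q / 4 + 19 / 4 := by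
  classical
  subst hq hcard
  have hinj : Function.Injective (Projectivization.rep : P2 F → Fin 3 → F) := fun a b h => by
    rw [← a.mk_rep, ← b.mk_rep]
    simp only [h]
  have hKcard : (K.toFinite.toFinset.image Projectivization.rep).card = K.ncard := by
    rw [Finset.card_image_of_injective _ hinj, Set.ncard_eq_toFinset_card K]
  rw [← hKcard]
  refine card_le_of_forall_conic hodd ?_ fun Q hQ hQ2 T hT hT0 => ?_
  · simp only [Finset.forall_mem_image]
    exact fun a _ b _ hab => Projectivization.exists_det₃_rep_ne_zero fun h => hab (by rw [h])
  · refine le_trans ?_ (hgen _ ⟨Q, hQ, hQ2, rfl⟩)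
    refine le_trans ?_ (Set.ncard_image_le (f := Projectivization.rep) (Set.toFinite _))
    rw [← Set.ncard_coe_finset]
    refine Set.ncard_le_ncard (fun Y hY => ?_) (Set.toFinite _)
    obtain ⟨a, ha, rfl⟩ := Finset.mem_image.1 (hT hY)
    exact ⟨a, ⟨K.toFinite.mem_toFinset.1 ha, hT0 _ hY⟩, rfl⟩
end
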